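/- arXiv:2102.05887 — 7 statements merged into one kernel-verified Lean document; each statement's English description precedes it below -/
import Mathlib

section
/- Let Ω ⊂ ℝ² be an open bounded convex set and let p = (p₁, p₂) ∈ L¹(Ω; ℝ²) satisfy div p = 0 in the sense of distributions, i.e. ∫_Ω p · ∇ψ dx = 0 for every ψ ∈ C_c^∞(Ω). Then there exists a function u ∈ L¹(Ω) whose distributional gradient equals R_{π/2} p = (−p₂, p₁); explicitly, for every ψ ∈ C_c^∞(Ω) one has ∫_Ω u ∂₁ψ dx = ∫_Ω p₂ ψ dx and ∫_Ω u ∂₂ψ dx = −∫_Ω p₁ ψ dx. In particular u belongs to W^{1,1}(Ω) and p = R_{−π/2} ∇u almost everywhere. -/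
open MeasureTheory Set Metric Filter
open scoped ENNReal NNReal Topology

noncomputable section

section ParametricIntegral

variable {H T : Type} [NormedAddCommGroup H] [NormedSpace ℝ H] [ProperSpace H]
  [NormedAddCommGroup T] [MeasurableSpace T] [BorelSpace T]
  [SecondCountableTopology T] {ν : Measure T} [IsLocallyFiniteMeasure ν] {K : Set T}

/-- Differentiation under the integral sign over a compact set, for a `C¹` integrand. -/
theorem hasFDerivAt_setIntegral_of_isCompact {F : Type} [NormedAddCommGroup F] [NormedSpace ℝ F]
    (hK : IsCompact K) {f : H → T → F} {f' : H → T → H →L[ℝ] F}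
    (hf : Continuous (Function.uncurry f)) (hf' : Continuous (Function.uncurry f'))
    (hff' : ∀ y t, HasFDerivAt (f · t) (f' y t) y) (y : H) :
    HasFDerivAt (fun y ↦ ∫ t in K, f y t ∂ν) (∫ t in K, f' y t ∂ν) y := by
  obtain ⟨C, hC⟩ := ((isCompact_closedBall y 1).prod hK).exists_bound_of_continuousOn
    hf'.continuousOn
  refine hasFDerivAt_integral_of_dominated_of_fderiv_le (bound := fun _ ↦ C) (F' := f')
    (ball_mem_nhds y one_pos) ?_ ?_ ?_ ?_ ?_ ?_
  · exact Eventually.of_forall fun z ↦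
      (hf.comp (Continuous.prodMk_right z)).aestronglyMeasurable
  · exact (hf.comp (Continuous.prodMk_right y)).continuousOn.integrableOn_compact hK
  · exact (hf'.comp (Continuous.prodMk_right y)).aestronglyMeasurable
  · filter_upwards [ae_restrict_mem hK.measurableSet] with t ht z hz
    exact hC (z, t) ⟨ball_subset_closedBall hz, ht⟩
  · exact continuousOn_const.integrableOn_compact hK
  · exact Eventually.of_forall fun t z _ ↦ hff' z t

/-- The integral over a compact set of a jointly smooth function is smooth in the parameter. -/
theorem contDiff_setIntegral_of_isCompact [NormedSpace ℝ T] {F : Type}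
    [NormedAddCommGroup F] [NormedSpace ℝ F]
    (hK : IsCompact K) {f : H → T → F} (hf : ContDiff ℝ (⊤ : ℕ∞) (Function.uncurry f)) :
    ContDiff ℝ (⊤ : ℕ∞) (fun y ↦ ∫ t in K, f y t ∂ν) := by
  rw [contDiff_infty]
  intro n
  induction n generalizing F with
  | zero =>
    refine contDiff_zero.2 ?_
    exact continuous_parametric_integral_of_continuous hf.continuous hK
  | succ n ih =>
    have hd : ∀ y t, HasFDerivAt (f · t) (fderiv ℝ (f · t) y) y := fun y t ↦ by
      have : ContDiff ℝ (⊤ : ℕ∞) (f · t) := hf.comp (contDiff_prodMk_left t)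
      exact (this.differentiable (by simp) y).hasFDerivAt
    have hs : ContDiff ℝ (⊤ : ℕ∞) (Function.uncurry fun y t ↦ fderiv ℝ (f · t) y) := by
      refine ContDiff.fderiv (f := fun (p : H × T) z ↦ f z p.2) (m := (⊤ : ℕ∞))
        (n := (⊤ : ℕ∞)) ?_ contDiff_fst (by simp)
      exact hf.comp (contDiff_snd.prodMk (contDiff_snd.comp contDiff_fst))
    have key := hasFDerivAt_setIntegral_of_isCompact (ν := ν) hK hf.continuous hs.continuous hd
    push_cast
    rw [contDiff_succ_iff_hasFDerivAt]
    exact ⟨_, ih hs, key⟩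

end ParametricIntegral

section RayKernel

variable {E : Type} [NormedAddCommGroup E] [NormedSpace ℝ E] [FiniteDimensional ℝ E]
  [MeasurableSpace E] [BorelSpace E] {μ : Measure E} [μ.IsAddHaarMeasure]

theorem setIntegral_Icc_prod_closedBall_eq {f : ℝ × E → ℝ} {D : ℝ}
    (hD : ∀ τ w, D < ‖w‖ → f (τ, w) = 0) :
    ∫ z in Icc (0 : ℝ) 1 ×ˢ closedBall (0 : E) D, f z ∂(volume.prod μ) =
      ∫ z, f z ∂((volume.restrict (Icc (0 : ℝ) 1)).prod μ) := by
  have : (volume.restrict (Icc (0 : ℝ) 1)).prod μ =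
      (volume.prod μ).restrict (Icc (0 : ℝ) 1 ×ˢ univ) := by
    rw [← Measure.prod_restrict, Measure.restrict_univ]
  rw [this]
  refine (setIntegral_eq_of_subset_of_forall_sdiff_eq_zero
    (measurableSet_Icc.prod MeasurableSet.univ)
    (prod_mono_right (subset_univ _)) ?_).symm
  rintro ⟨τ, w⟩ ⟨h1, h2⟩
  apply hD
  by_contra! h
  exact h2 ⟨h1.1, by simpa using h⟩

theorem integrable_Icc_prod {f : ℝ × E → ℝ} {D : ℝ} (hf : Continuous f)
    (hD : ∀ τ w, D < ‖w‖ → f (τ, w) = 0) :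
    Integrable f ((volume.restrict (Icc (0 : ℝ) 1)).prod μ) := by
  have : (volume.restrict (Icc (0 : ℝ) 1)).prod μ =
      (volume.prod μ).restrict (Icc (0 : ℝ) 1 ×ˢ univ) := by
    rw [← Measure.prod_restrict, Measure.restrict_univ]
  rw [this]
  refine IntegrableOn.of_forall_sdiff_eq_zero (hf.continuousOn.integrableOn_compact
    ((isCompact_Icc (a := (0 : ℝ)) (b := 1)).prod (isCompact_closedBall (0 : E) D)))
    (measurableSet_Icc.prod MeasurableSet.univ) ?_
  rintro ⟨τ, w⟩ ⟨h1, h2⟩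
  apply hD
  by_contra! h
  exact h2 ⟨h1.1, by simpa using h⟩

theorem integrable_of_continuous_of_norm {f : E → ℝ} {D : ℝ} (hf : Continuous f)
    (hD : ∀ w, D < ‖w‖ → f w = 0) : Integrable f μ := by
  refine hf.integrable_of_hasCompactSupport
    (HasCompactSupport.intro (isCompact_closedBall (0 : E) D) fun w hw ↦ hD w ?_)
  simpa using hw

/-- The derivative of `(a, x) ↦ θ a * φ x` in the diagonal direction `(z, z)`. -/
def diagDeriv (θ φ : E → ℝ) (a x z : E) : ℝ :=
  fderiv ℝ θ a z * φ x + θ a * fderiv ℝ φ x z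

variable {θ φ : E → ℝ} {D : ℝ}

theorem continuous_diagDeriv (hθ : ContDiff ℝ (⊤ : ℕ∞) θ) (hφ : ContDiff ℝ (⊤ : ℕ∞) φ)
    {X : Type} [TopologicalSpace X] {a x z : X → E} (ha : Continuous a) (hx : Continuous x)
    (hz : Continuous z) : Continuous fun t ↦ diagDeriv θ φ (a t) (x t) (z t) := by
  have h1 : Continuous (fderiv ℝ θ) := hθ.continuous_fderiv (by simp)
  have h2 : Continuous (fderiv ℝ φ) := hφ.continuous_fderiv (by simp)
  have h3 := hθ.continuous
  have h4 := hφ.continuous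
  unfold diagDeriv
  exact (((h1.comp ha).clm_apply hz).mul (h4.comp hx)).add
    ((h3.comp ha).mul ((h2.comp hx).clm_apply hz))

theorem eq_zero_or_of_lt (hD : ∀ a ∈ tsupport θ, ∀ x ∈ tsupport φ, ‖x - a‖ ≤ D)
    {y w : E} {τ : ℝ} (hw : D < ‖w‖) :
    (θ (y - τ • w) = 0 ∧ fderiv ℝ θ (y - τ • w) = 0) ∨
      (φ (y + (1 - τ) • w) = 0 ∧ fderiv ℝ φ (y + (1 - τ) • w) = 0) := by
  by_contra! h
  have h1 : y - τ • w ∈ tsupport θ := by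
    by_contra h'
    exact h.1 (image_eq_zero_of_notMem_tsupport h')
      (image_eq_zero_of_notMem_tsupport fun h'' ↦ h' (tsupport_fderiv_subset ℝ h''))
  have h2 : y + (1 - τ) • w ∈ tsupport φ := by
    by_contra h'
    exact h.2 (image_eq_zero_of_notMem_tsupport h')
      (image_eq_zero_of_notMem_tsupport fun h'' ↦ h' (tsupport_fderiv_subset ℝ h''))
  have h3 := hD _ h1 _ h2
  have h4 : y + (1 - τ) • w - (y - τ • w) = w := by module
  rw [h4] at h3
  linarith

theorem integral_sub_diagDeriv (hθ : ContDiff ℝ (⊤ : ℕ∞) θ) (hφ : ContDiff ℝ (⊤ : ℕ∞) φ)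
    (hD : ∀ a ∈ tsupport θ, ∀ x ∈ tsupport φ, ‖x - a‖ ≤ D) (y : E) :
    ∫ z : ℝ × E, (θ (y - z.1 • z.2) * φ (y + (1 - z.1) • z.2) -
      z.1 * diagDeriv θ φ (y - z.1 • z.2) (y + (1 - z.1) • z.2) z.2)
      ∂((volume.restrict (Icc (0 : ℝ) 1)).prod μ) = (∫ a, θ a ∂μ) * φ y := by
  have hcd : Continuous fun z : ℝ × E ↦
      diagDeriv θ φ (y - z.1 • z.2) (y + (1 - z.1) • z.2) z.2 :=
    continuous_diagDeriv hθ hφ (by fun_prop) (by fun_prop) (by fun_prop)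
  have hθc := hθ.continuous
  have hφc := hφ.continuous
  have hc : Continuous fun z : ℝ × E ↦ (θ (y - z.1 • z.2) * φ (y + (1 - z.1) • z.2) -
      z.1 * diagDeriv θ φ (y - z.1 • z.2) (y + (1 - z.1) • z.2) z.2) := by
    fun_prop
  rw [integral_prod_symm _ (integrable_Icc_prod (D := D) hc ?_)]
  · have key : ∀ w : E, ∫ τ in Icc (0 : ℝ) 1,
        (θ (y - τ • w) * φ (y + (1 - τ) • w) -
          τ * diagDeriv θ φ (y - τ • w) (y + (1 - τ) • w) w) = θ (y - w) * φ y := by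
      intro w
      rw [integral_Icc_eq_integral_Ioc, ← intervalIntegral.integral_of_le zero_le_one,
        intervalIntegral.integral_eq_sub_of_hasDerivAt
          (f := fun τ ↦ τ * (θ (y - τ • w) * φ (y + (1 - τ) • w)))]
      · simp
      · intro τ _
        have h1 : HasDerivAt (fun τ : ℝ ↦ y - τ • w) (-w) τ := by
          simpa using ((hasDerivAt_id τ).smul_const w).const_sub y
        have h2 : HasDerivAt (fun τ : ℝ ↦ y + (1 - τ) • w) (-w) τ := by
          simpa using (((hasDerivAt_id τ).const_sub 1).smul_const w).const_add y
        have h3 := ((hθ.differentiable (by simp) (y - τ • w)).hasFDerivAt).comp_hasDerivAt τ h1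
        have h4 := ((hφ.differentiable (by simp)
          (y + (1 - τ) • w)).hasFDerivAt).comp_hasDerivAt τ h2
        convert! (hasDerivAt_id τ).mul (h3.mul h4) using 1
        simp [diagDeriv]
        ring
      · exact (hc.comp (Continuous.prodMk_left w)).intervalIntegrable _ _
    simp only [key]
    rw [integral_mul_const, integral_sub_left_eq_self]
  · intro τ w hw
    rcases eq_zero_or_of_lt hD hw (y := y) (τ := τ) with h | h <;> simp [diagDeriv, h]

theorem integral_mul_fderiv_ray (hθ : ContDiff ℝ (⊤ : ℕ∞) θ) (hφ : ContDiff ℝ (⊤ : ℕ∞) φ)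
    (hD : ∀ a ∈ tsupport θ, ∀ x ∈ tsupport φ, ‖x - a‖ ≤ D) (L : E →L[ℝ] ℝ) (e y : E) (τ : ℝ) :
    ∫ w, θ (y - τ • w) * L w * fderiv ℝ φ (y + (1 - τ) • w) e ∂μ =
      ∫ w, (τ * (L w * diagDeriv θ φ (y - τ • w) (y + (1 - τ) • w) e) -
        L e * (θ (y - τ • w) * φ (y + (1 - τ) • w))) ∂μ := by
  have hθc := hθ.continuous
  have hφc := hφ.continuous
  have hθd : Continuous (fderiv ℝ θ) := hθ.continuous_fderiv (by simp)
  have hφd : Continuous (fderiv ℝ φ) := hφ.continuous_fderiv (by simp)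
  have hcd : Continuous fun w : E ↦
      diagDeriv θ φ (y - τ • w) (y + (1 - τ) • w) e :=
    continuous_diagDeriv hθ hφ (by fun_prop) (by fun_prop) (by fun_prop)
  set g : E → ℝ := fun w ↦ θ (y - τ • w) * φ (y + (1 - τ) • w) with hg
  have hgd : ∀ w, HasFDerivAt g (θ (y - τ • w) • ((1 - τ) • fderiv ℝ φ (y + (1 - τ) • w)) +
      φ (y + (1 - τ) • w) • (-(τ • fderiv ℝ θ (y - τ • w)))) w := by
    intro w
    have h1 : HasFDerivAt (fun w : E ↦ y - τ • w) (-(τ • ContinuousLinearMap.id ℝ E)) w := by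
      simpa using ((hasFDerivAt_id w).const_smul τ).const_sub y
    have h2 : HasFDerivAt (fun w : E ↦ y + (1 - τ) • w)
        ((1 - τ) • ContinuousLinearMap.id ℝ E) w := by
      simpa using ((hasFDerivAt_id w).const_smul (1 - τ)).const_add y
    have h3 := ((hθ.differentiable (by simp) (y - τ • w)).hasFDerivAt).comp w h1
    have h4 := ((hφ.differentiable (by simp) (y + (1 - τ) • w)).hasFDerivAt).comp w h2
    convert! h3.mul h4 using 1
    ext v
    simp
  have hge : ∀ w, fderiv ℝ g w e = θ (y - τ • w) * ((1 - τ) * fderiv ℝ φ (y + (1 - τ) • w) e) -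
      φ (y + (1 - τ) • w) * (τ * fderiv ℝ θ (y - τ • w) e) := by
    intro w
    rw [(hgd w).fderiv]
    simp
    ring
  have ibp := integral_mul_fderiv_eq_neg_fderiv_mul_of_integrable (μ := μ) (f := L) (g := g)
    (v := e) ?_ ?_ ?_ (fun x _ ↦ L.differentiableAt) (fun w _ ↦ (hgd w).differentiableAt)
  · simp only [ContinuousLinearMap.fderiv] at ibp
    have hi1 : Integrable (fun w ↦ L w * fderiv ℝ g w e) μ := by
      simp only [hge]
      refine integrable_of_continuous_of_norm (D := D) (by fun_prop) fun w hw ↦ ?_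
      rcases eq_zero_or_of_lt hD hw (y := y) (τ := τ) with h | h <;> simp [h]
    have hi2 : Integrable (fun w ↦ L e * g w) μ := by
      refine integrable_of_continuous_of_norm (D := D) (by fun_prop) fun w hw ↦ ?_
      rcases eq_zero_or_of_lt hD hw (y := y) (τ := τ) with h | h <;> simp [hg, h]
    have hi3 : Integrable (fun w ↦ τ * (L w * diagDeriv θ φ (y - τ • w) (y + (1 - τ) • w) e) -
        L e * g w) μ := by
      refine integrable_of_continuous_of_norm (D := D) (by fun_prop) fun w hw ↦ ?_
      rcases eq_zero_or_of_lt hD hw (y := y) (τ := τ) with h | h <;> simp [hg, h, diagDeriv]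
    rw [← sub_eq_zero, ← integral_neg] at ibp
    rw [← integral_sub hi1 (show Integrable (fun w ↦ -(L e * g w)) μ from hi2.neg)] at ibp
    rw [← add_zero (∫ w, (τ * (L w * diagDeriv θ φ (y - τ • w) (y + (1 - τ) • w) e) -
        L e * g w) ∂μ), ← ibp, ← integral_add hi3
      (show Integrable (fun w ↦ L w * fderiv ℝ g w e - -(L e * g w)) μ from hi1.sub hi2.neg)]
    refine integral_congr_ae (Eventually.of_forall fun w ↦ ?_)
    simp only [hge, diagDeriv]
    simp only [hg]
    ring
  all_goals
    try simp only [ContinuousLinearMap.fderiv, hge]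
    refine integrable_of_continuous_of_norm (D := D) (by fun_prop) fun w hw ↦ ?_
    rcases eq_zero_or_of_lt hD hw (y := y) (τ := τ) with h | h <;> simp [hg, h]

/-- The homotopy identity behind the averaged Poincaré operator. -/
theorem integral_ray_mul_fderiv (hθ : ContDiff ℝ (⊤ : ℕ∞) θ) (hφ : ContDiff ℝ (⊤ : ℕ∞) φ)
    (hD : ∀ a ∈ tsupport θ, ∀ x ∈ tsupport φ, ‖x - a‖ ≤ D) (L : E →L[ℝ] ℝ) (e y : E) :
    ∫ z : ℝ × E, θ (y - z.1 • z.2) * L z.2 * fderiv ℝ φ (y + (1 - z.1) • z.2) e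
      ∂((volume.restrict (Icc (0 : ℝ) 1)).prod μ) =
    ∫ z : ℝ × E, z.1 * diagDeriv θ φ (y - z.1 • z.2) (y + (1 - z.1) • z.2)
        (L z.2 • e - L e • z.2)
      ∂((volume.restrict (Icc (0 : ℝ) 1)).prod μ) - L e * ((∫ a, θ a ∂μ) * φ y) := by
  have hθc := hθ.continuous
  have hφc := hφ.continuous
  have hφd : Continuous (fderiv ℝ φ) := hφ.continuous_fderiv (by simp)
  have hcd : ∀ v : ℝ × E → E, Continuous v → Continuous fun z : ℝ × E ↦
      diagDeriv θ φ (y - z.1 • z.2) (y + (1 - z.1) • z.2) (v z) := fun v hv ↦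
    continuous_diagDeriv hθ hφ (by fun_prop) (by fun_prop) hv
  have hcd1 := hcd (fun z ↦ L z.2 • e - L e • z.2) (by fun_prop)
  have hcd2 := hcd (fun z ↦ e) (by fun_prop)
  have hz : ∀ (τ : ℝ) w, D < ‖w‖ → ∀ v, diagDeriv θ φ (y - τ • w) (y + (1 - τ) • w) v = 0 ∧
      θ (y - τ • w) * φ (y + (1 - τ) • w) = 0 ∧
      θ (y - τ • w) * fderiv ℝ φ (y + (1 - τ) • w) e = 0 := by
    intro τ w hw v
    rcases eq_zero_or_of_lt hD hw (y := y) (τ := τ) with h | h <;> simp [h, diagDeriv]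
  rw [← integral_sub_diagDeriv (μ := μ) hθ hφ hD y, ← integral_const_mul, ← integral_sub]
  · rw [integral_prod, integral_prod]
    · refine integral_congr_ae (Eventually.of_forall fun τ ↦ ?_)
      dsimp only
      rw [integral_mul_fderiv_ray hθ hφ hD]
      refine integral_congr_ae (Eventually.of_forall fun w ↦ ?_)
      simp [diagDeriv]
      ring
    · refine integrable_Icc_prod (D := D) (by fun_prop) fun τ w hw ↦ ?_
      simp only [(hz τ w hw _).1, (hz τ w hw 0).2.1, mul_zero, sub_zero]
    · refine integrable_Icc_prod (D := D) (by fun_prop) fun τ w hw ↦ ?_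
      rw [mul_right_comm]
      simp only [(hz τ w hw 0).2.2, zero_mul]
  · refine integrable_Icc_prod (D := D) (by fun_prop) fun τ w hw ↦ ?_
    simp only [(hz τ w hw _).1, mul_zero]
  · refine integrable_Icc_prod (D := D) (by fun_prop) fun τ w hw ↦ ?_
    simp only [(hz τ w hw _).1, (hz τ w hw 0).2.1, mul_zero, sub_zero]

end RayKernel

section RayPotential

variable {E : Type} [NormedAddCommGroup E] [NormedSpace ℝ E] [FiniteDimensional ℝ E]
  [MeasurableSpace E] [BorelSpace E] {μ : Measure E} [μ.IsAddHaarMeasure]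

/-- The average over all segments `[a, x]` through `y`, weighted by `τ * ω (x - a) * θ a * φ x`,
where `y = (1 - τ) • a + τ • x`. -/
def rayPotential (μ : Measure E) (θ φ : E → ℝ) (D : ℝ) (ω : E →L[ℝ] ℝ) (y : E) : ℝ :=
  ∫ z in Icc (0 : ℝ) 1 ×ˢ closedBall (0 : E) D,
    z.1 * ω z.2 * (θ (y - z.1 • z.2) * φ (y + (1 - z.1) • z.2)) ∂(volume.prod μ)

variable {θ φ : E → ℝ} {D : ℝ}

theorem contDiff_rayPotential (hθ : ContDiff ℝ (⊤ : ℕ∞) θ) (hφ : ContDiff ℝ (⊤ : ℕ∞) φ)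
    (ω : E →L[ℝ] ℝ) : ContDiff ℝ (⊤ : ℕ∞) (rayPotential μ θ φ D ω) := by
  refine contDiff_setIntegral_of_isCompact
    (f := fun (y : E) (z : ℝ × E) ↦
      z.1 * ω z.2 * (θ (y - z.1 • z.2) * φ (y + (1 - z.1) • z.2)))
    (isCompact_Icc.prod (isCompact_closedBall (0 : E) D)) ?_
  simp only [Function.uncurry_def]
  have h1 : ContDiff ℝ (⊤ : ℕ∞) fun p : E × ℝ × E ↦ θ (p.1 - p.2.1 • p.2.2) :=
    hθ.comp (by fun_prop)
  have h2 : ContDiff ℝ (⊤ : ℕ∞) fun p : E × ℝ × E ↦ φ (p.1 + (1 - p.2.1) • p.2.2) :=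
    hφ.comp (by fun_prop)
  fun_prop

theorem tsupport_rayPotential_subset {C : Set E} (hC : IsClosed C)
    (hθφ : ∀ a ∈ tsupport θ, ∀ x ∈ tsupport φ, segment ℝ a x ⊆ C) (ω : E →L[ℝ] ℝ) :
    tsupport (rayPotential μ θ φ D ω) ⊆ C := by
  refine closure_minimal (fun y hy ↦ ?_) hC
  by_contra hyC
  refine hy (setIntegral_eq_zero_of_forall_eq_zero ?_)
  rintro ⟨τ, w⟩ ⟨hτ, -⟩
  by_contra h
  simp only [mul_eq_zero, not_or] at h
  exact hyC (hθφ _ (subset_tsupport _ h.2.1) _ (subset_tsupport _ h.2.2)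
    ⟨1 - τ, τ, sub_nonneg.2 hτ.2, hτ.1, sub_add_cancel 1 τ, by module⟩)

theorem fderiv_rayPotential_apply (hθ : ContDiff ℝ (⊤ : ℕ∞) θ) (hφ : ContDiff ℝ (⊤ : ℕ∞) φ)
    (hD : ∀ a ∈ tsupport θ, ∀ x ∈ tsupport φ, ‖x - a‖ ≤ D) (ω : E →L[ℝ] ℝ) (y v : E) :
    fderiv ℝ (rayPotential μ θ φ D ω) y v =
      ∫ z : ℝ × E, z.1 * diagDeriv θ φ (y - z.1 • z.2) (y + (1 - z.1) • z.2) (ω z.2 • v)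
        ∂((volume.restrict (Icc (0 : ℝ) 1)).prod μ) := by
  have hθc := hθ.continuous
  have hφc := hφ.continuous
  have hθd : Continuous (fderiv ℝ θ) := hθ.continuous_fderiv (by simp)
  have hφd : Continuous (fderiv ℝ φ) := hφ.continuous_fderiv (by simp)
  set f' : E → ℝ × E → E →L[ℝ] ℝ := fun y z ↦ (z.1 * ω z.2) •
    (θ (y - z.1 • z.2) • fderiv ℝ φ (y + (1 - z.1) • z.2) +
      φ (y + (1 - z.1) • z.2) • fderiv ℝ θ (y - z.1 • z.2)) with hf'
  have hK : IsCompact (Icc (0 : ℝ) 1 ×ˢ closedBall (0 : E) D) :=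
    isCompact_Icc.prod (isCompact_closedBall (0 : E) D)
  have hc' : Continuous (Function.uncurry f') := by
    simp only [Function.uncurry_def, hf']
    fun_prop
  have hd := hasFDerivAt_setIntegral_of_isCompact (ν := volume.prod μ) hK
    (f := fun (y : E) (z : ℝ × E) ↦
      z.1 * ω z.2 * (θ (y - z.1 • z.2) * φ (y + (1 - z.1) • z.2))) (f' := f')
    (by simp only [Function.uncurry_def]; fun_prop) hc' (fun y z ↦ by
      have h3 := ((hθ.differentiable (by simp) (y - z.1 • z.2)).hasFDerivAt).comp y
        ((hasFDerivAt_id y).sub_const (z.1 • z.2))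
      have h4 := ((hφ.differentiable (by simp) (y + (1 - z.1) • z.2)).hasFDerivAt).comp y
        ((hasFDerivAt_id y).add_const ((1 - z.1) • z.2))
      exact (h3.mul h4).const_mul (z.1 * ω z.2)) y
  have hfd : fderiv ℝ (rayPotential μ θ φ D ω) y = _ := hd.fderiv
  have hi : IntegrableOn (f' y) (Icc (0 : ℝ) 1 ×ˢ closedBall (0 : E) D) (volume.prod μ) :=
    (hc'.comp (Continuous.prodMk_right y)).continuousOn.integrableOn_compact hK
  rw [hfd, ContinuousLinearMap.integral_apply hi, ← setIntegral_Icc_prod_closedBall_eq (D := D)]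
  · refine integral_congr_ae (Eventually.of_forall fun z ↦ ?_)
    simp [hf', diagDeriv]
    ring
  · intro τ w hw
    rcases eq_zero_or_of_lt hD hw (y := y) (τ := τ) with h | h <;> simp [diagDeriv, h]

end RayPotential

/-- In the plane, the homotopy identity expresses the averaged ray integral of a directional
derivative through the gradient of a test function. -/
theorem integral_ray_mul_fderiv_plane {θ φ : EuclideanSpace ℝ (Fin 2) → ℝ} {D : ℝ}
    (hθ : ContDiff ℝ (⊤ : ℕ∞) θ) (hφ : ContDiff ℝ (⊤ : ℕ∞) φ)
    (hD : ∀ a ∈ tsupport θ, ∀ x ∈ tsupport φ, ‖x - a‖ ≤ D) (hθ1 : ∫ a, θ a = 1)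
    (e y : EuclideanSpace ℝ (Fin 2)) (c₁ c₂ : ℝ) :
    ∫ z : ℝ × EuclideanSpace ℝ (Fin 2), θ (y - z.1 • z.2) * (c₁ * z.2 1 - c₂ * z.2 0) *
        fderiv ℝ φ (y + (1 - z.1) • z.2) e ∂((volume.restrict (Icc (0 : ℝ) 1)).prod volume) =
      -(c₁ * fderiv ℝ (rayPotential volume θ φ D
          (e 1 • EuclideanSpace.proj 0 - e 0 • EuclideanSpace.proj 1)) y
            (EuclideanSpace.single 0 1) +
        c₂ * fderiv ℝ (rayPotential volume θ φ D
          (e 1 • EuclideanSpace.proj 0 - e 0 • EuclideanSpace.proj 1)) y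
            (EuclideanSpace.single 1 1)) - (c₁ * e 1 - c₂ * e 0) * φ y := by
  have h := integral_ray_mul_fderiv (μ := volume) hθ hφ hD
    (c₁ • EuclideanSpace.proj 1 - c₂ • EuclideanSpace.proj 0) e y
  rw [hθ1, one_mul] at h
  have h1 : ∀ w : EuclideanSpace ℝ (Fin 2),
      (c₁ • EuclideanSpace.proj 1 - c₂ • EuclideanSpace.proj 0 :
        EuclideanSpace ℝ (Fin 2) →L[ℝ] ℝ) w = c₁ * w 1 - c₂ * w 0 := fun w ↦ by simp
  simp only [h1] at h
  rw [h]
  congr 1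
  have h2 : ∀ ℓ : EuclideanSpace ℝ (Fin 2) →L[ℝ] ℝ,
      -(c₁ * ℓ (EuclideanSpace.single 0 1) + c₂ * ℓ (EuclideanSpace.single 1 1)) =
        ℓ (-(c₁ • EuclideanSpace.single 0 1 + c₂ • EuclideanSpace.single 1 1)) := fun ℓ ↦ by
    simp only [map_neg, map_add, map_smul, smul_eq_mul]
  rw [h2, fderiv_rayPotential_apply hθ hφ hD]
  refine integral_congr_ae (Eventually.of_forall fun z ↦ ?_)
  dsimp only
  congr 2
  ext i
  fin_cases i <;> simp <;> ring

section Transport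

variable {E : Type} [NormedAddCommGroup E] [NormedSpace ℝ E] [FiniteDimensional ℝ E]
  [MeasurableSpace E] [BorelSpace E]

/-- The change of variables `((τ, w), y) ↦ ((τ, a), x)` with `w = x - a` and
`y = (1 - τ) • a + τ • x`. -/
def segmentEquiv : (ℝ × E) × E ≃ᵐ (ℝ × E) × E where
  toFun q := ((q.1.1, q.2 - q.1.1 • q.1.2), q.2 + (1 - q.1.1) • q.1.2)
  invFun q := ((q.1.1, q.2 - q.1.2), q.2 - (1 - q.1.1) • (q.2 - q.1.2))
  left_inv := by
    rintro ⟨⟨τ, w⟩, y⟩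
    refine Prod.ext (Prod.ext rfl ?_) ?_ <;> dsimp only <;> module
  right_inv := by
    rintro ⟨⟨τ, a⟩, x⟩
    refine Prod.ext (Prod.ext rfl ?_) ?_ <;> dsimp only <;> module
  measurable_toFun := by dsimp; fun_prop
  measurable_invFun := by dsimp; fun_prop

theorem measurePreserving_segmentEquiv (ν : Measure ℝ) [SFinite ν] (μ : Measure E)
    [μ.IsAddHaarMeasure] :
    MeasurePreserving (segmentEquiv (E := E)) ((ν.prod μ).prod μ) ((ν.prod μ).prod μ) := by
  refine MeasurePreserving.symm (segmentEquiv (E := E)).symm ?_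
  have h1 : MeasurePreserving (fun q : E × (ℝ × E) ↦ (q.1, (q.2.1, q.1 - q.2.2)))
      (μ.prod (ν.prod μ)) (μ.prod (ν.prod μ)) := by
    refine (MeasurePreserving.id μ).skew_product (g := fun x (p : ℝ × E) ↦ (p.1, x - p.2))
      (by simp only [Function.uncurry_def]; fun_prop) (Eventually.of_forall fun x ↦ ?_)
    exact ((MeasurePreserving.id ν).prod (Measure.measurePreserving_sub_left μ x)).map_eq
  have h2 : MeasurePreserving (fun q : (ℝ × E) × E ↦ (q.1, q.2 - (1 - q.1.1) • q.1.2))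
      ((ν.prod μ).prod μ) ((ν.prod μ).prod μ) := by
    refine (MeasurePreserving.id (ν.prod μ)).skew_product
      (g := fun (p : ℝ × E) x ↦ x - (1 - p.1) • p.2)
      (by simp only [Function.uncurry_def]; fun_prop) (Eventually.of_forall fun p ↦ ?_)
    exact (measurePreserving_sub_right μ _).map_eq
  exact h2.comp ((Measure.measurePreserving_swap).comp (h1.comp Measure.measurePreserving_swap))

theorem integrable_ray_kernel {ν : Measure ℝ} [IsFiniteMeasure ν] {μ : Measure E}
    [μ.IsAddHaarMeasure] {θ b c : E → ℝ} {A B D : ℝ} (hθm : Measurable θ)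
    (hbm : Measurable b) (hθ : ∀ a, ‖θ a‖ ≤ A) (hb : ∀ x, ‖b x‖ ≤ B)
    (hD : ∀ a x, θ a ≠ 0 → b x ≠ 0 → ‖x - a‖ ≤ D) (hc : Integrable c μ) (L : E →L[ℝ] ℝ) :
    Integrable (fun q : (ℝ × E) × E ↦ θ (q.2 - q.1.1 • q.1.2) * (c q.2 * L q.1.2) *
      b (q.2 + (1 - q.1.1) • q.1.2)) ((ν.prod μ).prod μ) := by
  have h1 : Integrable ((closedBall (0 : E) D).indicator L) μ :=
    (L.continuous.continuousOn.integrableOn_compact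
      (isCompact_closedBall (0 : E) D)).integrable_indicator measurableSet_closedBall
  have h2 := ((integrable_const (μ := ν) (1 : ℝ)).mul_prod h1).mul_prod hc
  have h3 := h2.bdd_mul (f := fun q : (ℝ × E) × E ↦ θ (q.2 - q.1.1 • q.1.2) *
      b (q.2 + (1 - q.1.1) • q.1.2)) (c := A * B)
    (by apply Measurable.aestronglyMeasurable; fun_prop)
    (Eventually.of_forall fun q ↦ by
      rw [norm_mul]
      exact mul_le_mul (hθ _) (hb _) (norm_nonneg _) ((norm_nonneg _).trans (hθ 0)))
  refine h3.congr (Eventually.of_forall ?_)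
  rintro ⟨⟨τ, w⟩, y⟩
  dsimp only
  by_cases hw : w ∈ closedBall (0 : E) D
  · rw [indicator_of_mem hw]
    ring
  · have : θ (y - τ • w) = 0 ∨ b (y + (1 - τ) • w) = 0 := by
      by_contra! h
      have h4 := hD _ _ h.1 h.2
      have h5 : y + (1 - τ) • w - (y - τ • w) = w := by module
      rw [h5] at h4
      exact hw (by simpa using h4)
    rcases this with h | h <;> simp [h]

end Transport

/-- The integrand of the averaged Poincaré operator applied to the field `(-c₂, c₁)`, at the point
`x - (1 - τ) • (x - a)` of the segment from `a` to `x`. -/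
def rayIntegrand (θ c₁ c₂ : EuclideanSpace ℝ (Fin 2) → ℝ)
    (q : (ℝ × EuclideanSpace ℝ (Fin 2)) × EuclideanSpace ℝ (Fin 2)) : ℝ :=
  θ q.1.2 * (c₁ (q.2 - (1 - q.1.1) • (q.2 - q.1.2)) * (q.2 - q.1.2) 1 -
    c₂ (q.2 - (1 - q.1.1) • (q.2 - q.1.2)) * (q.2 - q.1.2) 0)

theorem rayIntegrand_segmentEquiv (θ c₁ c₂ : EuclideanSpace ℝ (Fin 2) → ℝ) (τ : ℝ)
    (w y : EuclideanSpace ℝ (Fin 2)) :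
    rayIntegrand θ c₁ c₂ (segmentEquiv ((τ, w), y)) =
      θ (y - τ • w) * (c₁ y * w 1 - c₂ y * w 0) := by
  have h1 : y + (1 - τ) • w - (y - τ • w) = w := by module
  have h2 : y + (1 - τ) • w - (1 - τ) • w = y := by module
  change θ (y - τ • w) * (c₁ (y + (1 - τ) • w - (1 - τ) • (y + (1 - τ) • w - (y - τ • w))) *
    (y + (1 - τ) • w - (y - τ • w)) 1 -
    c₂ (y + (1 - τ) • w - (1 - τ) • (y + (1 - τ) • w - (y - τ • w))) *
    (y + (1 - τ) • w - (y - τ • w)) 0) = _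
  rw [h1, h2]

theorem integrable_rayIntegrand_mul {ν : Measure ℝ} [IsFiniteMeasure ν]
    {θ c₁ c₂ b : EuclideanSpace ℝ (Fin 2) → ℝ} {A B D : ℝ}
    (hθm : Measurable θ) (hbm : Measurable b) (hθ : ∀ a, ‖θ a‖ ≤ A) (hb : ∀ x, ‖b x‖ ≤ B)
    (hD : ∀ a x, θ a ≠ 0 → b x ≠ 0 → ‖x - a‖ ≤ D) (hc₁ : Integrable c₁) (hc₂ : Integrable c₂) :
    Integrable (fun q ↦ rayIntegrand θ c₁ c₂ q * b q.2) ((ν.prod volume).prod volume) := by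
  rw [← (measurePreserving_segmentEquiv ν volume).integrable_comp_emb
    segmentEquiv.measurableEmbedding]
  refine ((integrable_ray_kernel (ν := ν) hθm hbm hθ hb hD hc₁ (EuclideanSpace.proj 1)).sub
    (integrable_ray_kernel hθm hbm hθ hb hD hc₂ (EuclideanSpace.proj 0))).congr
    (Eventually.of_forall ?_)
  rintro ⟨⟨τ, w⟩, y⟩
  rw [Function.comp_apply, rayIntegrand_segmentEquiv]
  change _ = _ * b (y + (1 - τ) • w)
  simp
  ring

/-- The join of two compact sets is compact. -/
theorem IsCompact.convexJoin {E : Type} [AddCommGroup E] [Module ℝ E] [TopologicalSpace E]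
    [ContinuousAdd E] [ContinuousSMul ℝ E] {s t : Set E} (hs : IsCompact s) (ht : IsCompact t) :
    IsCompact (_root_.convexJoin ℝ s t) := by
  have h : _root_.convexJoin ℝ s t =
      (fun q : ℝ × E × E ↦ (1 - q.1) • q.2.1 + q.1 • q.2.2) '' (Icc 0 1 ×ˢ s ×ˢ t) := by
    ext x
    simp only [mem_convexJoin, segment_eq_image, mem_image, mem_prod, Prod.exists]
    constructor
    · rintro ⟨a, ha, b, hb, τ, hτ, rfl⟩
      exact ⟨τ, a, b, ⟨hτ, ha, hb⟩, rfl⟩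
    · rintro ⟨τ, a, b, ⟨hτ, ha, hb⟩, rfl⟩
      exact ⟨a, ha, b, hb, τ, hτ, rfl⟩
  rw [h]
  exact (isCompact_Icc.prod (hs.prod ht)).image (by fun_prop)

/-- a divergence-free `L¹` vector field on a planar convex domain is the
rotated (distributional) gradient of a `W^{1,1}` function. -/
theorem stmt4
    (Ω : Set (EuclideanSpace ℝ (Fin 2)))
    (hΩo : IsOpen Ω) (hΩb : Bornology.IsBounded Ω) (hΩc : Convex ℝ Ω)
    (p₁ p₂ : EuclideanSpace ℝ (Fin 2) → ℝ)
    (hp₁ : IntegrableOn p₁ Ω volume) (hp₂ : IntegrableOn p₂ Ω volume)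
    (hdiv : ∀ ψ : EuclideanSpace ℝ (Fin 2) → ℝ,
      ContDiff ℝ (⊤ : ℕ∞) ψ → HasCompactSupport ψ → tsupport ψ ⊆ Ω →
      (∫ x in Ω, (p₁ x * fderiv ℝ ψ x (EuclideanSpace.single 0 1) +
        p₂ x * fderiv ℝ ψ x (EuclideanSpace.single 1 1))) = 0) :
    ∃ u : EuclideanSpace ℝ (Fin 2) → ℝ, IntegrableOn u Ω volume ∧
      ∀ ψ : EuclideanSpace ℝ (Fin 2) → ℝ,
        ContDiff ℝ (⊤ : ℕ∞) ψ → HasCompactSupport ψ → tsupport ψ ⊆ Ω →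
        (∫ x in Ω, u x * fderiv ℝ ψ x (EuclideanSpace.single 0 1)) =
          (∫ x in Ω, p₂ x * ψ x) ∧
        (∫ x in Ω, u x * fderiv ℝ ψ x (EuclideanSpace.single 1 1)) =
          -(∫ x in Ω, p₁ x * ψ x) := by
  rcases Ω.eq_empty_or_nonempty with rfl | ⟨x₀, hx₀⟩
  · exact ⟨0, by simp, by simp⟩
  obtain ⟨r, hr, hrΩ⟩ := nhds_basis_closedBall.mem_iff.1 (hΩo.mem_nhds hx₀)
  let f : ContDiffBump x₀ := ⟨r / 2, r, half_pos hr, half_lt_self hr⟩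
  set θ : EuclideanSpace ℝ (Fin 2) → ℝ := f.normed volume with hθdef
  have hθ : ContDiff ℝ (⊤ : ℕ∞) θ := f.contDiff_normed
  have hθ1 : ∫ a, θ a = 1 := f.integral_normed
  have hθs : tsupport θ ⊆ Ω := by
    rw [hθdef, f.tsupport_normed_eq]
    exact hrΩ
  have hθk : HasCompactSupport θ := f.hasCompactSupport_normed
  obtain ⟨A, hA⟩ := hθk.exists_bound_of_continuous hθ.continuous
  have hD : ∀ a ∈ Ω, ∀ x ∈ Ω, ‖x - a‖ ≤ diam Ω := fun a ha x hx ↦ by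
    rw [← dist_eq_norm]
    exact dist_le_diam_of_mem hΩb hx ha
  set c₁ := Ω.indicator p₁ with hc₁def
  set c₂ := Ω.indicator p₂ with hc₂def
  have hc₁ : Integrable c₁ := hp₁.integrable_indicator hΩo.measurableSet
  have hc₂ : Integrable c₂ := hp₂.integrable_indicator hΩo.measurableSet
  set ν : Measure ℝ := volume.restrict (Icc 0 1) with hν
  have hint : ∀ (b : EuclideanSpace ℝ (Fin 2) → ℝ) (B : ℝ), Measurable b → (∀ x, ‖b x‖ ≤ B) →
      (∀ x, b x ≠ 0 → x ∈ Ω) → Integrable (fun q ↦ rayIntegrand θ c₁ c₂ q * b q.2)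
        ((ν.prod volume).prod volume) := fun b B hbm hb hbΩ ↦
    integrable_rayIntegrand_mul hθ.continuous.measurable hbm hA hb
      (fun a x ha hx ↦ hD a (hθs (subset_tsupport _ ha)) x (hbΩ x hx)) hc₁ hc₂
  set u : EuclideanSpace ℝ (Fin 2) → ℝ := fun x ↦
    ∫ z, rayIntegrand θ c₁ c₂ (z, x) * Ω.indicator (fun _ ↦ (1 : ℝ)) x ∂(ν.prod volume) with hu
  have hui : Integrable u :=
    (hint (Ω.indicator fun _ ↦ 1) 1 (measurable_const.indicator hΩo.measurableSet)
      (fun x ↦ (norm_indicator_le_norm_self _ _).trans (by simp))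
      (fun x hx ↦ mem_of_indicator_ne_zero hx)).integral_prod_right
  refine ⟨u, hui.integrableOn, fun φ hφ hφk hφs ↦ ?_⟩
  have main : ∀ e, ∫ x in Ω, u x * fderiv ℝ φ x e = -∫ x in Ω, (p₁ x * e 1 - p₂ x * e 0) * φ x := by
    intro e
    have hgs : ∀ x, fderiv ℝ φ x e ≠ 0 → x ∈ Ω := fun x hx ↦
      hφs (tsupport_fderiv_apply_subset ℝ e (subset_tsupport _ hx))
    have hgc : Continuous fun x ↦ fderiv ℝ φ x e :=
      (hφ.continuous_fderiv (by simp)).clm_apply continuous_const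
    obtain ⟨B, hB⟩ := (hφk.fderiv_apply (𝕜 := ℝ) e).exists_bound_of_continuous hgc
    have hgi := hint (fun x ↦ fderiv ℝ φ x e) B hgc.measurable hB hgs
    have hDs : ∀ a ∈ tsupport θ, ∀ x ∈ tsupport φ, ‖x - a‖ ≤ diam Ω :=
      fun a ha x hx ↦ hD a (hθs ha) x (hφs hx)
    set ψ := rayPotential volume θ φ (diam Ω)
      (e 1 • EuclideanSpace.proj 0 - e 0 • EuclideanSpace.proj 1)
    have hψ : ContDiff ℝ (⊤ : ℕ∞) ψ := contDiff_rayPotential hθ hφ _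
    set C := convexJoin ℝ (tsupport θ) (tsupport φ)
    have hC : IsCompact C := hθk.isCompact.convexJoin hφk.isCompact
    have hψC : tsupport ψ ⊆ C :=
      tsupport_rayPotential_subset hC.isClosed
        (fun a ha x hx ↦ segment_subset_convexJoin ha hx) _
    have hψk : HasCompactSupport ψ := hC.of_isClosed_subset (isClosed_tsupport _) hψC
    have hψ0 := hdiv ψ hψ hψk (hψC.trans (convexJoin_subset hθs hφs hΩc))
    have hmul : ∀ {p g : EuclideanSpace ℝ (Fin 2) → ℝ}, IntegrableOn p Ω → Continuous g →
        HasCompactSupport g → IntegrableOn (fun x ↦ p x * g x) Ω := by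
      intro p g hp hg hgk
      obtain ⟨M, hM⟩ := hgk.exists_bound_of_continuous hg
      exact hp.mul_bdd hg.aestronglyMeasurable (Eventually.of_forall hM)
    have hψd : ∀ v, IntegrableOn (fun x ↦ p₁ x * fderiv ℝ ψ x v) Ω ∧
        IntegrableOn (fun x ↦ p₂ x * fderiv ℝ ψ x v) Ω := fun v ↦
      have hc := (hψ.continuous_fderiv (by simp)).clm_apply (continuous_const (y := v))
      ⟨hmul hp₁ hc (hψk.fderiv_apply (𝕜 := ℝ) v), hmul hp₂ hc (hψk.fderiv_apply (𝕜 := ℝ) v)⟩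
    have hφi : IntegrableOn (fun x ↦ (p₁ x * e 1 - p₂ x * e 0) * φ x) Ω :=
      hmul ((hp₁.mul_const _).sub (hp₂.mul_const _)) hφ.continuous hφk
    calc ∫ x in Ω, u x * fderiv ℝ φ x e
        = ∫ x, u x * fderiv ℝ φ x e := by
          refine setIntegral_eq_integral_of_forall_compl_eq_zero fun x hx ↦ ?_
          rw [not_not.1 fun h ↦ hx (hgs x h), mul_zero]
      _ = ∫ x, ∫ z, rayIntegrand θ c₁ c₂ (z, x) * fderiv ℝ φ x e ∂(ν.prod volume) := by
          refine integral_congr_ae (Eventually.of_forall fun x ↦ ?_)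
          simp only [hu]
          rw [← integral_mul_const]
          refine integral_congr_ae (Eventually.of_forall fun z ↦ ?_)
          by_cases hx : x ∈ Ω
          · simp [hx]
          · simp [not_not.1 fun h ↦ hx (hgs x h)]
      _ = ∫ q, rayIntegrand θ c₁ c₂ q * fderiv ℝ φ q.2 e ∂((ν.prod volume).prod volume) :=
          (integral_prod_symm _ hgi).symm
      _ = ∫ q, rayIntegrand θ c₁ c₂ (segmentEquiv q) * fderiv ℝ φ (segmentEquiv q).2 e
            ∂((ν.prod volume).prod volume) :=
          ((measurePreserving_segmentEquiv ν volume).integral_comp' _).symm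
      _ = ∫ y, ∫ z, rayIntegrand θ c₁ c₂ (segmentEquiv (z, y)) *
            fderiv ℝ φ (segmentEquiv (z, y)).2 e ∂(ν.prod volume) :=
          integral_prod_symm _ (((measurePreserving_segmentEquiv ν volume).integrable_comp_emb
            segmentEquiv.measurableEmbedding).2 hgi)
      _ = ∫ y, (-(c₁ y * fderiv ℝ ψ y (EuclideanSpace.single 0 1) +
            c₂ y * fderiv ℝ ψ y (EuclideanSpace.single 1 1)) - (c₁ y * e 1 - c₂ y * e 0) * φ y) := by
          refine integral_congr_ae (Eventually.of_forall fun y ↦ ?_)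
          dsimp only
          rw [← integral_ray_mul_fderiv_plane hθ hφ hDs hθ1]
          refine integral_congr_ae (Eventually.of_forall fun z ↦ ?_)
          exact congrArg (· * _) (rayIntegrand_segmentEquiv θ c₁ c₂ z.1 z.2 y)
      _ = ∫ y in Ω, (-(p₁ y * fderiv ℝ ψ y (EuclideanSpace.single 0 1) +
            p₂ y * fderiv ℝ ψ y (EuclideanSpace.single 1 1)) - (p₁ y * e 1 - p₂ y * e 0) * φ y) := by
          rw [← integral_indicator hΩo.measurableSet]
          refine integral_congr_ae (Eventually.of_forall fun y ↦ ?_)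
          by_cases hy : y ∈ Ω <;> simp [hc₁def, hc₂def, hy]
      _ = -∫ x in Ω, (p₁ x * e 1 - p₂ x * e 0) * φ x := by
          have hi : IntegrableOn (fun y ↦ -(p₁ y * fderiv ℝ ψ y (EuclideanSpace.single 0 1) +
              p₂ y * fderiv ℝ ψ y (EuclideanSpace.single 1 1))) Ω :=
            ((hψd _).1.add (hψd _).2).neg
          rw [integral_sub hi hφi, integral_neg, hψ0, neg_zero, zero_sub]
  constructor
  · rw [main, ← integral_neg]
    simp
  · rw [main]
    simp
end
end

section
/- Let Ω ⊂ ℝ² be an open bounded convex set and let z ∈ L^∞(Ω; ℝ²) satisfy |z(x)| ≤ 1 for almost every x ∈ Ω and div z = 0 in the sense of distributions, i.e. ∫_Ω z · ∇ψ dx = 0 for every ψ ∈ C_c^∞(Ω). Then there exists a 1-Lipschitz function φ : Ω̄ → ℝ such that φ is differentiable at almost every point of Ω and z = R_{π/2} ∇φ almost everywhere in Ω; explicitly, z(x) = (−∂₂φ(x), ∂₁φ(x)) for a.e. x ∈ Ω. -/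
open MeasureTheory Set Metric Filter
open scoped ENNReal NNReal Topology

noncomputable section

open scoped Convolution

/-- A sequence of `1`-Lipschitz functions vanishing at the origin has a subsequence converging
pointwise on a given compact set to a `1`-Lipschitz function. -/
theorem exists_subseq_tendsto_of_lipschitzWith_one {E : Type*} [NormedAddCommGroup E] {K : Set E}
    (hK : IsCompact K) (f : ℕ → E → ℝ) (hf : ∀ n, LipschitzWith 1 (f n)) (hf0 : ∀ n, f n 0 = 0) :
    ∃ g : E → ℝ, LipschitzWith 1 g ∧ ∃ s : ℕ → ℕ, StrictMono s ∧
      ∀ x ∈ K, Tendsto (fun n => f (s n) x) atTop (𝓝 (g x)) := by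
  classical
  have : CompactSpace K := isCompact_iff_compactSpace.1 hK
  obtain ⟨R, hR⟩ := hK.isBounded.exists_norm_le
  let F : ℕ → BoundedContinuousFunction K ℝ := fun n =>
    BoundedContinuousFunction.mkOfCompact ⟨fun x => f n x, (hf n).continuous.comp (by fun_prop)⟩
  have hc : IsCompact (closure (range F)) := by
    refine BoundedContinuousFunction.arzela_ascoli (closedBall 0 R) (isCompact_closedBall _ _) _
      ?_ ?_
    · rintro _ x ⟨n, rfl⟩
      have := (hf n).dist_le_mul x 0
      simp only [hf0, NNReal.coe_one, one_mul, dist_zero_right] at this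
      simpa [F] using this.trans (hR x x.2)
    · refine (LipschitzWith.uniformEquicontinuous _ 1 ?_).equicontinuous
      rintro ⟨_, n, rfl⟩
      exact (hf n).comp (LipschitzWith.subtype_val K) |>.weaken (by simp)
  obtain ⟨G, -, s, hs, hG⟩ := hc.tendsto_subseq (x := F) fun n => subset_closure ⟨n, rfl⟩
  have hlim : ∀ x : K, Tendsto (fun n => f (s n) x) atTop (𝓝 (G x)) := fun x =>
    (BoundedContinuousFunction.tendsto_iff_tendstoUniformly.1 hG).tendsto_at x
  have hGL : LipschitzOnWith 1 (fun x => if h : x ∈ K then G ⟨x, h⟩ else 0) K := by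
    refine LipschitzOnWith.of_dist_le_mul fun x hx y hy => ?_
    simp only [hx, hy, dite_true]
    exact le_of_tendsto ((hlim ⟨x, hx⟩).dist (hlim ⟨y, hy⟩))
      (Eventually.of_forall fun n => (hf (s n)).dist_le_mul x y)
  obtain ⟨g, hg, hgG⟩ := hGL.extend_real
  refine ⟨g, hg, s, hs, fun x hx => ?_⟩
  have := hgG hx
  simp only [hx] at this
  exact this ▸ hlim ⟨x, hx⟩

section Potential

variable {E : Type*} [NormedAddCommGroup E] [NormedSpace ℝ E]

/-- The set of centers of closed balls of radius `r` contained in a convex set is convex. -/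
theorem Convex.setOf_closedBall_subset {Ω : Set E} (hΩ : Convex ℝ Ω) (r : ℝ) :
    Convex ℝ {x | closedBall x r ⊆ Ω} := by
  intro x hx y hy a b ha hb hab w hw
  set v := w - (a • x + b • y) with hv
  have hvr : ‖v‖ ≤ r := by simpa [hv, dist_eq_norm] using hw
  have hw' : w = a • (x + v) + b • (y + v) := by
    have : a • v + b • v = v := by rw [← add_smul, hab, one_smul]
    calc w = a • x + b • y + (a • v + b • v) := by rw [this, hv]; abel
      _ = _ := by simp only [smul_add]; abel
  rw [hw']
  exact hΩ (hx (by simpa [dist_eq_norm] using hvr)) (hy (by simpa [dist_eq_norm] using hvr))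
    ha hb hab

variable [MeasurableSpace E] [BorelSpace E] [FiniteDimensional ℝ E]
  {μ : Measure E} [μ.IsAddHaarMeasure]

/-- Mollification does not increase a uniform bound on the norm. -/
theorem ContDiffBump.norm_normed_convolution_le {F : Type*} [NormedAddCommGroup F]
    [NormedSpace ℝ F] [CompleteSpace F] (ρ : ContDiffBump (0 : E)) {W : E → F} {C : ℝ}
    (hC : 0 ≤ C) (hWm : AEStronglyMeasurable W μ) (hW : ∀ x, ‖W x‖ ≤ C) (x : E) :
    ‖(ρ.normed μ ⋆[ContinuousLinearMap.lsmul ℝ ℝ, μ] W) x‖ ≤ C := by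
  simpa using dist_convolution_le (μ := μ) (z₀ := (0 : F)) (x₀ := x) hC
    ρ.support_normed_eq.subset ρ.nonneg_normed ρ.integral_normed hWm
    (fun y _ => by simpa using hW y)

/-- A `1`-form is weakly closed on `Ω` if its exterior derivative vanishes on `Ω` in the sense of
distributions. -/
def IsWeaklyClosedOn (W : E → E →L[ℝ] ℝ) (Ω : Set E) (μ : Measure E) : Prop :=
  ∀ ψ : E → ℝ, ContDiff ℝ (⊤ : ℕ∞) ψ → HasCompactSupport ψ → tsupport ψ ⊆ Ω → ∀ u v : E,
    ∫ x, (fderiv ℝ ψ x u * W x v - fderiv ℝ ψ x v * W x u) ∂μ = 0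

/-- The mollification of a weakly closed `1`-form is closed away from the boundary. -/
theorem IsWeaklyClosedOn.exists_hasFDerivAt_convolution {W : E → E →L[ℝ] ℝ} {Ω : Set E}
    (hW : LocallyIntegrable W μ) (hcl : IsWeaklyClosedOn W Ω μ)
    {ρ : E → ℝ} (hρ : ContDiff ℝ (⊤ : ℕ∞) ρ) (hρc : HasCompactSupport ρ) {r : ℝ}
    (hρr : tsupport ρ ⊆ closedBall 0 r) {x : E} (hx : closedBall x r ⊆ Ω) :
    ∃ D : E →L[ℝ] E →L[ℝ] ℝ,
      HasFDerivAt (ρ ⋆[ContinuousLinearMap.lsmul ℝ ℝ, μ] W) D x ∧ ∀ u v, D u v = D v u := by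
  have hd : ContDiff ℝ (⊤ : ℕ∞) (fderiv ℝ ρ) := hρ.fderiv_right (by simp)
  have hdc : HasCompactSupport (fderiv ℝ ρ) := hρc.fderiv ℝ
  have hint := (hdc.convolutionExists_left (𝕜 := ℝ) (μ := μ) (F := E →L[ℝ] E →L[ℝ] ℝ)
    ((ContinuousLinearMap.lsmul ℝ ℝ : ℝ →L[ℝ] (E →L[ℝ] ℝ) →L[ℝ] _).precompL E)
    hd.continuous hW) x
  have hint2 : ∀ u v, Integrable (fun t => fderiv ℝ ρ t u * W (x - t) v) μ := fun u v => by
    simpa using (hint.integrable.apply_continuousLinearMap u).apply_continuousLinearMap v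
  refine ⟨_, hρc.hasFDerivAt_convolution_left _ (hρ.of_le (by simp)) hW x, fun u v => ?_⟩
  have happ : ∀ u v, convolution (𝕜 := ℝ) (F := E →L[ℝ] E →L[ℝ] ℝ) (fderiv ℝ ρ) W
      ((ContinuousLinearMap.lsmul ℝ ℝ : ℝ →L[ℝ] (E →L[ℝ] ℝ) →L[ℝ] _).precompL E) μ x u v
      = ∫ t, fderiv ℝ ρ t u * W (x - t) v ∂μ := fun u v => by
    rw [convolution_def, ContinuousLinearMap.integral_apply hint.integrable,
      ContinuousLinearMap.integral_apply (hint.integrable.apply_continuousLinearMap u)]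
    simp
  rw [happ, happ, ← sub_eq_zero, ← integral_sub (hint2 _ _) (hint2 _ _),
    ← integral_sub_left_eq_self _ μ x]
  have hψ : ∀ y w, fderiv ℝ (fun y => ρ (x - y)) y w = - fderiv ℝ ρ (x - y) w := fun y w => by
    have h := (hρ.differentiable (by simp) (x - y)).hasFDerivAt.comp y
      ((hasFDerivAt_id y).const_sub x)
    simpa [Function.comp_def] using congrArg (· w) h.fderiv
  have key := hcl (fun y => ρ (x - y)) (hρ.comp (contDiff_const.sub contDiff_id))
    (hρc.comp_homeomorph (Homeomorph.subLeft x)) ?_ u v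
  · simp only [hψ] at key
    rw [← neg_eq_zero, ← integral_neg, ← key]
    congr 1 with y
    simp only [sub_sub_cancel]
    ring
  · refine subset_trans (fun y hy => ?_) hx
    have := hρr ((tsupport_comp_subset_preimage ρ (f := fun y => x - y) (by fun_prop)) hy)
    simpa [dist_eq_norm, norm_sub_rev] using this

/-- A mollification of a weakly closed `1`-form of norm at most one on a convex set is, away from
the boundary, the derivative of a `1`-Lipschitz function. -/
theorem IsWeaklyClosedOn.exists_lipschitzWith_hasFDerivAt_convolution
    {W : E → E →L[ℝ] ℝ} {Ω : Set E} (hΩ : Convex ℝ Ω)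
    (hWm : StronglyMeasurable W) (hW1 : ∀ x, ‖W x‖ ≤ 1)
    (hcl : IsWeaklyClosedOn W Ω μ) (ρ : ContDiffBump (0 : E)) :
    ∃ f : E → ℝ, LipschitzWith 1 f ∧ f 0 = 0 ∧
      ∀ x ∈ interior {x | closedBall x ρ.rOut ⊆ Ω},
        HasFDerivAt f ((ρ.normed μ ⋆[ContinuousLinearMap.lsmul ℝ ℝ, μ] W) x) x := by
  set U := interior {x | closedBall x ρ.rOut ⊆ Ω} with hU
  have hUc : Convex ℝ U := (hΩ.setOf_closedBall_subset _).interior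
  have hUo : IsOpen U := isOpen_interior
  have hWl : LocallyIntegrable W μ :=
    (locallyIntegrable_const (1 : ℝ)).mono hWm.aestronglyMeasurable
      (.of_forall fun x => by simpa using hW1 x)
  have hD : ∀ x, ∃ D : E →L[ℝ] E →L[ℝ] ℝ, x ∈ U →
      HasFDerivAt (ρ.normed μ ⋆[ContinuousLinearMap.lsmul ℝ ℝ, μ] W) D x ∧
        ∀ u v, D u v = D v u := fun x => by
    by_cases hx : x ∈ U
    · obtain ⟨D, hD⟩ := hcl.exists_hasFDerivAt_convolution hWl (ρ.contDiff_normed (μ := μ))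
        ρ.hasCompactSupport_normed ρ.tsupport_normed_eq.subset (interior_subset hx)
      exact ⟨D, fun _ => hD⟩
    · exact ⟨0, fun h => absurd h hx⟩
  choose D hD using hD
  obtain ⟨f, hf⟩ := hUc.exists_forall_hasFDerivWithinAt_of_hasFDerivWithinAt_symmetric
    (fun x hx => (hD x hx).1.hasFDerivWithinAt) (fun x hx u _ v _ => (hD x hx).2 u v)
  have hb := ρ.norm_normed_convolution_le (μ := μ) zero_le_one hWm.aestronglyMeasurable hW1
  obtain ⟨g, hg, hgf⟩ := (hUc.lipschitzOnWith_of_nnnorm_hasFDerivWithin_le (C := 1) hf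
    (fun x _ => by simpa [← NNReal.coe_le_coe] using hb x)).extend_real
  refine ⟨fun x => g x - g 0, by simpa using hg.sub (LipschitzWith.const (g 0)), by simp,
    fun x hx => HasFDerivAt.sub_const _ ?_⟩
  exact ((hf x hx).hasFDerivAt (hUo.mem_nhds hx)).congr_of_eventuallyEq
    (eventually_of_mem (hUo.mem_nhds hx) fun y hy => (hgf hy).symm)

/-- A weakly closed `1`-form of norm at most one on a bounded convex open set is almost everywhere
the derivative of a `1`-Lipschitz function. -/
theorem IsWeaklyClosedOn.exists_lipschitzWith_ae_hasFDerivAt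
    {W : E → E →L[ℝ] ℝ} {Ω : Set E} (hΩo : IsOpen Ω) (hΩb : Bornology.IsBounded Ω)
    (hΩc : Convex ℝ Ω) (hWm : StronglyMeasurable W) (hW1 : ∀ x, ‖W x‖ ≤ 1)
    (hcl : IsWeaklyClosedOn W Ω μ) :
    ∃ f : E → ℝ, LipschitzWith 1 f ∧ ∀ᵐ x ∂μ, x ∈ Ω → HasFDerivAt f (W x) x := by
  have hWl : LocallyIntegrable W μ :=
    (locallyIntegrable_const (1 : ℝ)).mono hWm.aestronglyMeasurable
      (.of_forall fun x => by simpa using hW1 x)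
  let ρ : ℕ → ContDiffBump (0 : E) := fun n =>
    ⟨1 / ((n : ℝ) + 1) / 2, 1 / ((n : ℝ) + 1), by positivity, half_lt_self (by positivity)⟩
  have hρ0 : Tendsto (fun n => (ρ n).rOut) atTop (𝓝 0) := tendsto_one_div_add_atTop_nhds_zero_nat
  let F : ℕ → E → E →L[ℝ] ℝ := fun n => (ρ n).normed μ ⋆[ContinuousLinearMap.lsmul ℝ ℝ, μ] W
  have hF1 : ∀ n x, ‖F n x‖ ≤ 1 := fun n =>
    (ρ n).norm_normed_convolution_le zero_le_one hWm.aestronglyMeasurable hW1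
  have hFc : ∀ n, Continuous (F n) := fun n =>
    (ρ n).hasCompactSupport_normed.continuous_convolution_left _ (ρ n).continuous_normed hWl
  have hFW : ∀ᵐ x ∂μ, Tendsto (fun n => F n x) atTop (𝓝 (W x)) :=
    ContDiffBump.ae_convolution_tendsto_right_of_locallyIntegrable (K := 2) hρ0
      (Eventually.of_forall fun n => by simp [ρ]; ring_nf; rfl) hWl
  choose f hf hf0 hfF using fun n =>
    hcl.exists_lipschitzWith_hasFDerivAt_convolution hΩc hWm hW1 (ρ n)
  obtain ⟨g, hg, s, hs, hlim⟩ := exists_subseq_tendsto_of_lipschitzWith_one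
    hΩb.isCompact_closure f hf hf0
  have hWi : ∀ v, LocallyIntegrable (fun x => W x v) μ := fun v => fun x => by
    obtain ⟨t, ht, hi⟩ := hWl x
    exact ⟨t, ht, hi.apply_continuousLinearMap v⟩
  have hgm : ∀ v, Measurable fun x => lineDeriv ℝ g x v := fun v =>
    measurable_lineDeriv hg.continuous
  have hgi : ∀ v, LocallyIntegrable (fun x => lineDeriv ℝ g x v) μ := fun v => by
    refine LocallyIntegrable.mono (locallyIntegrable_const ‖v‖) (hgm v).aestronglyMeasurable ?_
    refine Eventually.of_forall fun x => ?_
    simpa using norm_lineDeriv_le_of_lipschitz ℝ hg (x₀ := x) (v := v)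
  have hae : ∀ v, ∀ᵐ x ∂μ, x ∈ Ω → lineDeriv ℝ g x v - W x v = 0 := fun v => by
    refine hΩo.ae_eq_zero_of_integral_contDiff_smul_eq_zero
      (((hgi v).sub (hWi v)).locallyIntegrableOn Ω) fun ψ hψ hψc hψΩ => ?_
    obtain ⟨C, hψL⟩ := hψ.lipschitzWith_of_hasCompactSupport hψc (by simp)
    obtain ⟨δ, hδ, hδΩ⟩ := hψc.exists_cthickening_subset_open hΩo hψΩ
    have hψW : Integrable (fun x => W x v * ψ x) μ := by
      simpa [mul_comm] using (hWi v).integrable_smul_left_of_hasCompactSupport hψ.continuous hψc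
    have hψg : Integrable (fun x => lineDeriv ℝ g x v * ψ x) μ := by
      simpa [mul_comm] using (hgi v).integrable_smul_left_of_hasCompactSupport hψ.continuous hψc
    have hparts : ∀ᶠ n in atTop, ∫ x, F (s n) x v * ψ x ∂μ
        = ∫ x, lineDeriv ℝ ψ x (-v) * f (s n) x ∂μ := by
      filter_upwards [(hρ0.comp hs.tendsto_atTop).eventually (gt_mem_nhds (half_pos hδ))]
        with n hn
      rw [← LipschitzWith.integral_lineDeriv_mul_eq (hf (s n)) hψL hψc]
      congr 1 with x
      by_cases hx : x ∈ tsupport ψ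
      · congr 1
        refine ((hfF (s n) x ?_).hasLineDerivAt v).lineDeriv.symm
        rw [mem_interior_iff_mem_nhds]
        filter_upwards [ball_mem_nhds x (half_pos hδ)] with y hy w hw
        refine hδΩ (mem_cthickening_of_dist_le w x δ _ hx ?_)
        have h1 := dist_triangle w y x
        have h2 : dist w y ≤ (ρ (s n)).rOut := hw
        have h3 : dist y x < δ / 2 := hy
        have h4 : (ρ (s n)).rOut < δ / 2 := hn
        linarith
      · simp [image_eq_zero_of_notMem_tsupport hx]
    have hψd : ∀ x, lineDeriv ℝ ψ x (-v) = fderiv ℝ ψ x (-v) := fun x =>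
      (hψ.differentiable (by simp) x).lineDeriv_eq_fderiv
    have hψdc : Continuous fun x => lineDeriv ℝ ψ x (-v) := by
      simp only [hψd]
      exact (hψ.continuous_fderiv (by simp)).clm_apply continuous_const
    have hψds : ∀ x, x ∉ tsupport ψ → lineDeriv ℝ ψ x (-v) = 0 := fun x hx => by
      rw [hψd, fderiv_of_notMem_tsupport ℝ hx]; rfl
    have hψdcs : HasCompactSupport fun x => lineDeriv ℝ ψ x (-v) :=
      HasCompactSupport.intro hψc fun x hx => hψds x hx
    have hL : Tendsto (fun n => ∫ x, F (s n) x v * ψ x ∂μ) atTop (𝓝 (∫ x, W x v * ψ x ∂μ)) := by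
      refine tendsto_integral_of_dominated_convergence (fun x => ‖v‖ * ‖ψ x‖) (fun n => ?_) ?_
        (fun n => Eventually.of_forall fun x => ?_) ?_
      · exact (((hFc _).clm_apply continuous_const).mul hψ.continuous).aestronglyMeasurable
      · exact ((hψ.continuous.integrable_of_hasCompactSupport hψc).norm).const_mul _
      · rw [norm_mul]
        gcongr
        simpa using (F (s n) x).le_of_opNorm_le (hF1 _ x) v
      · filter_upwards [hFW] with x hx
        have h1 := hx.comp hs.tendsto_atTop
        have h2 : Tendsto (fun n => F (s n) x v) atTop (𝓝 (W x v)) :=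
          ((ContinuousLinearMap.apply ℝ ℝ v).continuous.tendsto _).comp h1
        exact h2.mul_const _
    have hR : Tendsto (fun n => ∫ x, lineDeriv ℝ ψ x (-v) * f (s n) x ∂μ) atTop
        (𝓝 (∫ x, lineDeriv ℝ ψ x (-v) * g x ∂μ)) := by
      refine tendsto_integral_of_dominated_convergence
        (fun x => ‖lineDeriv ℝ ψ x (-v)‖ * ‖x‖) (fun n => ?_) ?_
        (fun n => Eventually.of_forall fun x => ?_) (Eventually.of_forall fun x => ?_)
      · exact (hψdc.mul (hf _).continuous).aestronglyMeasurable
      · exact (hψdc.norm.mul continuous_norm).integrable_of_hasCompactSupport hψdcs.norm.mul_right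
      · rw [norm_mul]
        gcongr
        simpa [hf0] using (hf (s n)).dist_le_mul x 0
      · by_cases hx : x ∈ tsupport ψ
        · exact (hlim x (subset_closure (hψΩ hx))).const_mul _
        · simp [hψds x hx]
    have heq := tendsto_nhds_unique (hL.congr' hparts) hR
    rw [← LipschitzWith.integral_lineDeriv_mul_eq hg hψL hψc] at heq
    rw [← sub_eq_zero.2 heq.symm, ← integral_sub hψg hψW]
    congr 1 with x
    rw [smul_eq_mul]
    ring
  refine ⟨g, hg, ?_⟩
  let b := Module.finBasis ℝ E
  filter_upwards [hg.ae_differentiableAt (μ := μ), ae_all_iff.2 fun i => hae (b i)]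
    with x hxd hx hxΩ
  have : fderiv ℝ g x = W x := by
    refine ContinuousLinearMap.coe_injective (b.ext fun i => ?_)
    have := hx i hxΩ
    rw [hxd.lineDeriv_eq_fderiv] at this
    exact sub_eq_zero.1 this
  exact this ▸ hxd.hasFDerivAt

end Potential

/-- a divergence-free vector field `z` with `|z| ≤ 1` a.e. on a planar convex
domain is the rotation by `π/2` of the gradient of a `1`-Lipschitz function (a Kantorovich
potential). -/
theorem stmt5
    (Ω : Set (EuclideanSpace ℝ (Fin 2)))
    (hΩo : IsOpen Ω) (hΩb : Bornology.IsBounded Ω) (hΩc : Convex ℝ Ω)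
    (z : EuclideanSpace ℝ (Fin 2) → EuclideanSpace ℝ (Fin 2))
    (hzm : Measurable z)
    (hz1 : ∀ᵐ x ∂(volume.restrict Ω), ‖z x‖ ≤ 1)
    (hdiv : ∀ ψ : EuclideanSpace ℝ (Fin 2) → ℝ,
      ContDiff ℝ (⊤ : ℕ∞) ψ → HasCompactSupport ψ → tsupport ψ ⊆ Ω →
      (∫ x in Ω, (z x 0 * fderiv ℝ ψ x (EuclideanSpace.single 0 1) +
        z x 1 * fderiv ℝ ψ x (EuclideanSpace.single 1 1))) = 0) :
    ∃ φ : EuclideanSpace ℝ (Fin 2) → ℝ, LipschitzOnWith 1 φ (closure Ω) ∧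
      ∀ᵐ x ∂(volume.restrict Ω), DifferentiableAt ℝ φ x ∧
        z x 0 = -(fderiv ℝ φ x (EuclideanSpace.single 1 1)) ∧
        z x 1 = fderiv ℝ φ x (EuclideanSpace.single 0 1) := by
  set Z := (Ω ∩ {x | ‖z x‖ ≤ 1}).indicator z with hZ
  have hZm : Measurable Z :=
    hzm.indicator (hΩo.measurableSet.inter (measurableSet_le hzm.norm measurable_const))
  have hZ1 : ∀ x, ‖Z x‖ ≤ 1 := fun x => by
    by_cases hx : x ∈ Ω ∩ {x | ‖z x‖ ≤ 1}
    · simpa [hZ, hx] using hx.2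
    · simp [hZ, hx]
  have hzZ : ∀ᵐ x ∂(volume.restrict Ω), z x = Z x := by
    filter_upwards [hz1, ae_restrict_mem hΩo.measurableSet] with x hx hxΩ
    simp [hZ, hx, hxΩ]
  have hZΩ : ∀ x, x ∉ Ω → Z x = 0 := fun x hx => by simp [hZ, hx]
  have hZi : ∀ i, Measurable fun x => Z x i := fun i =>
    (EuclideanSpace.proj i : EuclideanSpace ℝ (Fin 2) →L[ℝ] ℝ).continuous.measurable.comp hZm
  let p : Fin 2 → EuclideanSpace ℝ (Fin 2) →L[ℝ] ℝ := fun i => EuclideanSpace.proj i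
  let W : EuclideanSpace ℝ (Fin 2) → EuclideanSpace ℝ (Fin 2) →L[ℝ] ℝ :=
    fun x => Z x 1 • p 0 - Z x 0 • p 1
  have hWm : StronglyMeasurable W :=
    ((hZi 1).stronglyMeasurable.smul_const _).sub ((hZi 0).stronglyMeasurable.smul_const _)
  have hWapp : ∀ x h, W x h = Z x 1 * h 0 - Z x 0 * h 1 := fun _ _ => rfl
  have hW1 : ∀ x, ‖W x‖ ≤ 1 := fun x => by
    refine ContinuousLinearMap.opNorm_le_bound _ zero_le_one fun h => ?_
    refine le_trans ?_ (mul_le_mul_of_nonneg_right (hZ1 x) (norm_nonneg h))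
    refine abs_le_of_sq_le_sq ?_ (by positivity)
    rw [mul_pow, EuclideanSpace.real_norm_sq_eq, EuclideanSpace.real_norm_sq_eq]
    rw [hWapp, Fin.sum_univ_two, Fin.sum_univ_two]
    nlinarith [sq_nonneg (Z x 0 * h 0 + Z x 1 * h 1)]
  have hcl : IsWeaklyClosedOn W Ω volume := fun ψ hψ hψc hψΩ u v => by
    have hdecomp : ∀ (L : EuclideanSpace ℝ (Fin 2) →L[ℝ] ℝ) (w : EuclideanSpace ℝ (Fin 2)),
        L w = w 0 * L (EuclideanSpace.single 0 1) + w 1 * L (EuclideanSpace.single 1 1) :=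
      fun L w => by
        have : w = w 0 • EuclideanSpace.single 0 (1 : ℝ) + w 1 • EuclideanSpace.single 1 1 := by
          ext i; fin_cases i <;> simp
        conv_lhs => rw [this]
        simp
    have key := hdiv ψ hψ hψc hψΩ
    rw [integral_congr_ae (g := fun x => Z x 0 * fderiv ℝ ψ x (EuclideanSpace.single 0 1) +
        Z x 1 * fderiv ℝ ψ x (EuclideanSpace.single 1 1))
      (by filter_upwards [hzZ] with x hx; rw [hx]),
      setIntegral_eq_integral_of_forall_compl_eq_zero (fun x hx => by simp [hZΩ x hx])] at key
    rw [← mul_zero (u 1 * v 0 - u 0 * v 1), ← key, ← integral_const_mul]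
    congr 1 with x
    rw [hdecomp (fderiv ℝ ψ x) u, hdecomp (fderiv ℝ ψ x) v, hWapp, hWapp]
    ring
  obtain ⟨φ, hφ, hφW⟩ := hcl.exists_lipschitzWith_ae_hasFDerivAt hΩo hΩb hΩc hWm hW1
  refine ⟨φ, hφ.lipschitzOnWith, ?_⟩
  filter_upwards [hzZ, ae_restrict_of_ae hφW, ae_restrict_mem hΩo.measurableSet]
    with x hx hxφ hxΩ
  refine ⟨(hxφ hxΩ).differentiableAt, ?_, ?_⟩ <;> simp [(hxφ hxΩ).fderiv, hx, hWapp]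
end
end

section
/- Let Ω ⊂ ℝ² be an open bounded convex set, let f⁺ and f⁻ be finite positive Borel measures on ∂Ω with f⁺(∂Ω) = f⁻(∂Ω), and let γ be any transport plan between f⁺ and f⁻. Then the total mass of the transport density satisfies σ_γ(Ω̄) ≤ (diam(Ω)/2) · (f⁺(∂Ω) + f⁻(∂Ω)). (Via the correspondence |Du| = σ_γ this yields the sharp estimate |Du|(Ω) ≤ (diam(Ω)/2)·|Dg|(∂Ω) for solutions of the least gradient problem.) -/
open MeasureTheory Set Metric Filter
open scoped ENNReal NNReal Topology

noncomputable section

/-- A transport plan between the measures `μ` and `ν`: a positive measure on the product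
whose first marginal is `μ` and whose second marginal is `ν`. -/
def IsTransportPlan {α : Type*} [MeasurableSpace α] (μ ν : Measure α)
    (γ : Measure (α × α)) : Prop :=
  γ.map Prod.fst = μ ∧ γ.map Prod.snd = ν

/-- The transport cost of a plan `γ` for the distance cost `c(x,y) = |x - y|`. -/
def transportCost {α : Type*} [MeasurableSpace α] [PseudoEMetricSpace α]
    (γ : Measure (α × α)) : ℝ≥0∞ :=
  ∫⁻ p, edist p.1 p.2 ∂γ

/-- `γ` is an optimal transport plan between `μ` and `ν` for the cost `|x - y|`. -/
def IsOptimalPlan {α : Type*} [MeasurableSpace α] [PseudoEMetricSpace α] (μ ν : Measure α)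
    (γ : Measure (α × α)) : Prop :=
  IsTransportPlan μ ν γ ∧
    ∀ γ' : Measure (α × α), IsTransportPlan μ ν γ' → transportCost γ ≤ transportCost γ'

/-- The transport density of a plan `γ`, as a set function:
`σ_γ(A) = ∫ ℋ¹([x,y] ∩ A) dγ(x,y)`. -/
def transportDensity {d : ℕ}
    (γ : Measure (EuclideanSpace ℝ (Fin d) × EuclideanSpace ℝ (Fin d)))
    (A : Set (EuclideanSpace ℝ (Fin d))) : ℝ≥0∞ :=
  ∫⁻ p, μH[1] (segment ℝ p.1 p.2 ∩ A) ∂γ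

/-- An open bounded set `Ω` is uniformly convex if it is convex and there is `R > 0` such
that for every boundary point `x` there is a unit vector `n` with `Ω ⊆ B(x + Rn, R)`. -/
def UniformlyConvexSet {d : ℕ} (Ω : Set (EuclideanSpace ℝ (Fin d))) : Prop :=
  Convex ℝ Ω ∧ ∃ R > (0 : ℝ), ∀ x ∈ frontier Ω, ∃ n : EuclideanSpace ℝ (Fin d),
    ‖n‖ = 1 ∧ Ω ⊆ Metric.ball (x + R • n) R

/-- The (topological) support of a measure: the points all of whose neighbourhoods have
positive measure.  For finite Borel measures on a second-countable space this is the smallest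
closed set of full measure. -/
def msupport {α : Type*} [TopologicalSpace α] [MeasurableSpace α] (μ : Measure α) : Set α :=
  {x | ∀ U ∈ nhds x, μ U ≠ 0}

/-- total-mass estimate for the transport density,
`σ_γ(Ω̄) ≤ (diam Ω / 2) (f⁺(∂Ω) + f⁻(∂Ω))`. -/
theorem stmt6
    (Ω : Set (EuclideanSpace ℝ (Fin 2)))
    (hΩo : IsOpen Ω) (hΩb : Bornology.IsBounded Ω) (hΩc : Convex ℝ Ω)
    (fplus fminus : Measure (EuclideanSpace ℝ (Fin 2)))
    [IsFiniteMeasure fplus] [IsFiniteMeasure fminus]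
    (hfp : fplus ((frontier Ω)ᶜ) = 0) (hfm : fminus ((frontier Ω)ᶜ) = 0)
    (hmass : fplus (frontier Ω) = fminus (frontier Ω))
    (γ : Measure (EuclideanSpace ℝ (Fin 2) × EuclideanSpace ℝ (Fin 2)))
    (hγ : IsTransportPlan fplus fminus γ) :
    transportDensity γ (closure Ω) ≤
      ENNReal.ofReal (Metric.diam Ω / 2) * (fplus (frontier Ω) + fminus (frontier Ω)) := by
  obtain ⟨h₁, h₂⟩ := hγ
  have hx : ∀ᵐ p ∂γ, p.1 ∈ frontier Ω := by
    refine ae_of_ae_map measurable_fst.aemeasurable ?_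
    rw [h₁]
    exact hfp
  have hy : ∀ᵐ p ∂γ, p.2 ∈ frontier Ω := by
    refine ae_of_ae_map measurable_snd.aemeasurable ?_
    rw [h₂]
    exact hfm
  have hγ_univ : γ univ = fplus (frontier Ω) := by
    rw [measure_of_measure_compl_eq_zero hfp, ← h₁, Measure.map_apply measurable_fst .univ,
      preimage_univ]
  calc transportDensity γ (closure Ω)
      ≤ ∫⁻ _, ENNReal.ofReal (Metric.diam Ω) ∂γ := by
        refine lintegral_mono_ae ?_
        filter_upwards [hx, hy] with p hp₁ hp₂
        calc μH[1] (segment ℝ p.1 p.2 ∩ closure Ω)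
            ≤ μH[1] (segment ℝ p.1 p.2) := measure_mono inter_subset_left
          _ = edist p.1 p.2 := hausdorffMeasure_segment _ _
          _ ≤ ENNReal.ofReal (Metric.diam Ω) := by
            rw [edist_dist, ← Metric.diam_closure]
            exact ENNReal.ofReal_le_ofReal (Metric.dist_le_diam_of_mem hΩb.closure
              (frontier_subset_closure hp₁) (frontier_subset_closure hp₂))
    _ = ENNReal.ofReal (Metric.diam Ω / 2) * (fplus (frontier Ω) + fminus (frontier Ω)) := by
        rw [lintegral_const, hγ_univ, ← hmass, mul_add, ← add_mul,
          ← ENNReal.ofReal_add (by positivity) (by positivity), add_halves]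
end
end

section
/- Let Ω ⊂ ℝ^d be an open bounded set whose closure Ω̄ is strictly convex (every open segment between two distinct points of Ω̄ lies in Ω). Then for every finite positive Borel measure γ on Ω̄ × Ω̄ concentrated on ∂Ω × ∂Ω, the transport density gives no mass to the boundary: σ_γ(∂Ω) = ∫ ℋ¹([x,y] ∩ ∂Ω) dγ(x,y) = 0. -/
open MeasureTheory Set Metric Filter
open scoped ENNReal NNReal Topology

noncomputable section

/-- on a strictly convex domain, any measure concentrated on `∂Ω × ∂Ω` has
transport density giving no mass to the boundary. -/
theorem stmt9 {d : ℕ} (Ω : Set (EuclideanSpace ℝ (Fin d)))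
    (hΩo : IsOpen Ω) (hΩb : Bornology.IsBounded Ω)
    (hsc : ∀ x ∈ closure Ω, ∀ y ∈ closure Ω, x ≠ y → openSegment ℝ x y ⊆ Ω)
    (γ : Measure (EuclideanSpace ℝ (Fin d) × EuclideanSpace ℝ (Fin d))) [IsFiniteMeasure γ]
    (hγc : γ ((frontier Ω ×ˢ frontier Ω)ᶜ) = 0) :
    (∫⁻ p, μH[1] (segment ℝ p.1 p.2 ∩ frontier Ω) ∂γ) = 0 := by
  have hae : ∀ᵐ p ∂γ, p ∈ frontier Ω ×ˢ frontier Ω := hγc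
  have := Measure.nullSingletonClass_hausdorff (EuclideanSpace ℝ (Fin d)) zero_lt_one
  have h0 : (fun p : EuclideanSpace ℝ (Fin d) × EuclideanSpace ℝ (Fin d) =>
      μH[1] (segment ℝ p.1 p.2 ∩ frontier Ω)) =ᵐ[γ] 0 := by
    filter_upwards [hae] with p hp
    refine measure_mono_null (t := {p.1, p.2}) ?_ ((Set.toFinite _).measure_zero _)
    rintro z ⟨hz, hzf⟩
    by_cases hxy : p.1 = p.2
    · rw [hxy, segment_same] at hz
      exact Or.inr hz
    · rw [← insert_endpoints_openSegment] at hz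
      rcases hz with hz | hz | hz
      · exact Or.inl hz
      · exact Or.inr hz
      · have hzΩ := hsc _ (frontier_subset_closure hp.1) _ (frontier_subset_closure hp.2) hxy hz
        exact absurd hzΩ ((disjoint_frontier_iff_isOpen.2 hΩo).notMem_of_mem_left hzf)
  rw [lintegral_congr_ae h0]
  simp
end
end

section
/- Let Ω, Ω' ⊂ ℝ² be open bounded convex sets with Ω ⊆ Ω', and suppose Ω' is strictly convex. Let π : ∂Ω' → ℝ² assign to each x ∈ ∂Ω' the unique nearest point of the closed convex set Ω̄ to x. Then π(x) ∈ ∂Ω for every x ∈ ∂Ω', and π maps ∂Ω' onto ∂Ω: for every y ∈ ∂Ω there exists x ∈ ∂Ω' with π(x) = y. -/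
open MeasureTheory Set Metric Filter
open scoped ENNReal NNReal Topology

noncomputable section

/-- A closest point of `closure s` to a point outside the open set `s` lies on the frontier. -/
theorem mem_frontier_of_dist_eq_infDist {E : Type*} [NormedAddCommGroup E] [NormedSpace ℝ E]
    {s : Set E} (hs : IsOpen s) {x p : E} (hx : x ∉ s) (hp : p ∈ closure s)
    (hd : dist x p = infDist x (closure s)) : p ∈ frontier s := by
  rw [hs.frontier_eq]
  refine ⟨hp, fun hps => ?_⟩
  have hxp : 0 < dist x p := dist_pos.2 fun h => hx (h ▸ hps)
  have hcont : Tendsto (fun t : ℝ => AffineMap.lineMap p x t) (𝓝[>] 0) (𝓝 p) := by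
    have h : Continuous fun t : ℝ => AffineMap.lineMap p x t := AffineMap.lineMap_continuous
    simpa using (h.tendsto 0).mono_left nhdsWithin_le_nhds
  obtain ⟨t, hts, ht⟩ := ((hcont.eventually (hs.mem_nhds hps)).and
    (Ioo_mem_nhdsGT (zero_lt_one' ℝ))).exists
  have hle := infDist_le_dist_of_mem (x := x) (subset_closure hts)
  rw [← hd, dist_comm x (AffineMap.lineMap p x t), dist_lineMap_right, Real.norm_eq_abs,
    abs_of_pos (sub_pos.2 ht.2), dist_comm p x] at hle
  nlinarith [ht.1]

/-- A ray issued from a point of the closure of a bounded open set meets its frontier. -/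
theorem exists_ray_mem_frontier {E : Type*} [NormedAddCommGroup E] [NormedSpace ℝ E]
    {s : Set E} (hs : IsOpen s) (hb : Bornology.IsBounded s) {y v : E}
    (hy : y ∈ closure s) (hv : v ≠ 0) : ∃ t : ℝ, 0 ≤ t ∧ y + t • v ∈ frontier s := by
  have hcont : Continuous fun t : ℝ => y + t • v := by fun_prop
  obtain ⟨C, hC⟩ := hb.closure.exists_norm_le
  set T : Set ℝ := Ici 0 ∩ (fun t : ℝ => y + t • v) ⁻¹' closure s with hT
  have hTc : IsClosed T := isClosed_Ici.inter (isClosed_closure.preimage hcont)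
  have hTne : T.Nonempty := ⟨0, by simpa [hT] using hy⟩
  have hTb : BddAbove T := by
    refine ⟨(C + C) / ‖v‖, fun t ht => ?_⟩
    rw [le_div_iff₀ (norm_pos_iff.2 hv)]
    have h : ‖t • v‖ ≤ ‖y + t • v‖ + ‖y‖ := by
      simpa using norm_sub_le (y + t • v) y
    rw [norm_smul, Real.norm_eq_abs, abs_of_nonneg (mem_Ici.1 ht.1)] at h
    linarith [hC _ ht.2, hC _ hy]
  have hmem := hTc.csSup_mem hTne hTb
  refine ⟨sSup T, hmem.1, ?_⟩
  rw [hs.frontier_eq]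
  refine ⟨hmem.2, fun hin => ?_⟩
  have hev : ∀ᶠ t in 𝓝[>] sSup T, y + t • v ∈ s :=
    nhdsWithin_le_nhds (hcont.continuousAt.eventually (hs.mem_nhds hin))
  obtain ⟨t, hts, ht⟩ := (hev.and self_mem_nhdsWithin).exists
  exact (not_le.2 ht) (le_csSup hTb ⟨mem_Ici.2 ((mem_Ici.1 hmem.1).trans (le_of_lt ht)),
    subset_closure hts⟩)

/-- An open convex set has a nonzero outer normal vector at each point outside it. -/
theorem exists_inner_le_of_notMem {E : Type*} [NormedAddCommGroup E] [InnerProductSpace ℝ E]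
    [CompleteSpace E] {s : Set E} (hs : IsOpen s) (hc : Convex ℝ s) (hne : s.Nonempty) {y : E}
    (hy : y ∉ s) : ∃ v : E, v ≠ 0 ∧ ∀ w ∈ closure s, inner ℝ v (w - y) ≤ 0 := by
  obtain ⟨f, hf⟩ := geometric_hahn_banach_open_point hc hs hy
  refine ⟨(InnerProductSpace.toDual ℝ E).symm f, fun h => ?_, fun w hw => ?_⟩
  · obtain ⟨a, ha⟩ := hne
    have hf0 : f = 0 := by simpa using h
    simpa [hf0] using hf a ha
  · rw [InnerProductSpace.toDual_symm_apply, map_sub, sub_nonpos]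
    exact closure_minimal (fun a ha => (hf a ha).le)
      (isClosed_le f.continuous continuous_const) hw

/-- A point on an outer normal ray at `y` is strictly closer to `y` than to any other point of the
supporting half-space. -/
theorem eq_of_dist_le_of_inner_le {E : Type*} [NormedAddCommGroup E] [InnerProductSpace ℝ E]
    {y v p : E} {t : ℝ} (ht : 0 ≤ t) (hp : inner ℝ v (p - y) ≤ 0)
    (hd : dist (y + t • v) p ≤ dist (y + t • v) y) : p = y := by
  have h : y + t • v - p = t • v - (p - y) := by abel
  rw [dist_eq_norm, dist_eq_norm, h, add_sub_cancel_left] at hd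
  have hsq := pow_le_pow_left₀ (norm_nonneg _) hd 2
  rw [norm_sub_sq_real, real_inner_smul_left] at hsq
  have hz : ‖p - y‖ ^ 2 ≤ 0 := by nlinarith [mul_nonpos_of_nonneg_of_nonpos ht hp]
  exact sub_eq_zero.1 (norm_eq_zero.1 (pow_eq_zero_iff two_ne_zero |>.1
    (le_antisymm hz (sq_nonneg _))))

/-- the metric projection `π` onto the closure of a convex set `Ω` maps the
boundary of a larger strictly convex set `Ω'` onto `∂Ω`. -/
theorem stmt14 (Ω Ω' : Set (EuclideanSpace ℝ (Fin 2)))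
    (hΩo : IsOpen Ω) (hΩb : Bornology.IsBounded Ω) (hΩc : Convex ℝ Ω) (hne : Ω.Nonempty)
    (hΩ'o : IsOpen Ω') (hΩ'b : Bornology.IsBounded Ω') (hΩ'c : Convex ℝ Ω')
    (hsub : Ω ⊆ Ω')
    (hsc : ∀ x ∈ closure Ω', ∀ y ∈ closure Ω', x ≠ y → openSegment ℝ x y ⊆ Ω')
    (π : EuclideanSpace ℝ (Fin 2) → EuclideanSpace ℝ (Fin 2))
    (hπmem : ∀ x, π x ∈ closure Ω)
    (hπdist : ∀ x, dist x (π x) = Metric.infDist x (closure Ω)) :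
    (∀ x ∈ frontier Ω', π x ∈ frontier Ω) ∧
    (∀ y ∈ frontier Ω, ∃ x ∈ frontier Ω', π x = y) := by
  refine ⟨fun x hx => ?_, fun y hy => ?_⟩
  · rw [hΩ'o.frontier_eq] at hx
    exact mem_frontier_of_dist_eq_infDist hΩo (fun h => hx.2 (hsub h)) (hπmem x) (hπdist x)
  · rw [hΩo.frontier_eq] at hy
    obtain ⟨v, hv, hvle⟩ := exists_inner_le_of_notMem hΩo hΩc hne hy.2
    obtain ⟨t, ht, hx⟩ := exists_ray_mem_frontier hΩ'o hΩ'b (closure_mono hsub hy.1) hv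
    refine ⟨_, hx, eq_of_dist_le_of_inner_le ht (hvle _ (hπmem _)) ?_⟩
    rw [hπdist]
    exact infDist_le_dist_of_mem hy.1
end
end

section
/- Let Ω ⊂ ℝ² be an open bounded convex set, and let f⁺ and f⁻ be finite positive Borel measures on ∂Ω with f⁺(∂Ω) = f⁻(∂Ω) and with the following property: for every pair of distinct points x, y ∈ ∂Ω such that the closed segment [x,y] is contained in ∂Ω, one has min(f⁺([x,y]), f⁻([x,y])) = 0. Then for every transport plan γ between f⁺ and f⁻ that is optimal for the cost |x−y|, the transport density gives no mass to the boundary: σ_γ(∂Ω) = 0. (This is the key step establishing existence of solutions to the least gradient problem on convex, not necessarily strictly convex, domains when the boundary datum is monotone on each boundary segment.) -/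
open MeasureTheory Set Metric Filter
open scoped ENNReal NNReal Topology

noncomputable section

/-- A point of the frontier of an open convex set admits a supporting functional. -/
theorem exists_supporting_functional {E : Type*} [NormedAddCommGroup E] [NormedSpace ℝ E]
    {Ω : Set E} (hΩo : IsOpen Ω) (hΩc : Convex ℝ Ω) {p : E} (hp : p ∈ frontier Ω) :
    ∃ f : E →L[ℝ] ℝ, (∀ z ∈ Ω, f z < f p) ∧ ∀ z ∈ closure Ω, f z ≤ f p := by
  have hpΩ : p ∉ Ω := by
    rw [hΩo.frontier_eq] at hp
    exact hp.2
  obtain ⟨f, hf⟩ := geometric_hahn_banach_open_point hΩc hΩo hpΩ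
  refine ⟨f, hf, fun z hz ↦ ?_⟩
  have hcl : closure Ω ⊆ {z | f z ≤ f p} :=
    closure_minimal (fun z hz ↦ (hf z hz).le) (isClosed_le f.continuous continuous_const)
  exact hcl hz

/-- A linear functional which is maximal on a segment at a relative interior point
is constant on the segment. -/
theorem eq_of_mem_openSegment_of_le {E : Type*} [NormedAddCommGroup E] [NormedSpace ℝ E]
    (f : E →L[ℝ] ℝ) {p x y : E} (hp : p ∈ openSegment ℝ x y) (hx : f x ≤ f p)
    (hy : f y ≤ f p) : f x = f p ∧ f y = f p := by
  obtain ⟨a, b, ha, hb, hab, rfl⟩ := hp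
  simp only [map_add, map_smul, smul_eq_mul] at *
  obtain rfl : b = 1 - a := by linarith
  have h1 : f x ≤ f y := by nlinarith
  have h2 : f y ≤ f x := by nlinarith
  have h : f x = f y := le_antisymm h1 h2
  rw [h]
  constructor <;> ring

/-- A nondegenerate exposed face of a bounded open convex planar set is a segment. -/
theorem exists_segment_of_supporting_functional {E : Type*} [NormedAddCommGroup E]
    [NormedSpace ℝ E] (hE : Module.finrank ℝ E = 2) {Ω : Set E} (hΩo : IsOpen Ω)
    (hΩb : Bornology.IsBounded Ω) (hΩc : Convex ℝ Ω) (hne : Ω.Nonempty) {p : E}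
    {f : E →L[ℝ] ℝ} (hf : ∀ z ∈ Ω, f z < f p) {x y : E} (hxy : x ≠ y)
    (hx : x ∈ closure Ω) (hy : y ∈ closure Ω) (hfx : f x = f p) (hfy : f y = f p) :
    ∃ a ∈ frontier Ω, ∃ b ∈ frontier Ω, a ≠ b ∧ segment ℝ a b ⊆ frontier Ω ∧
      ∀ z ∈ closure Ω, f z = f p → z ∈ segment ℝ a b := by
  have : FiniteDimensional ℝ E := Module.finite_of_finrank_pos (by omega)
  have hf0 : (f : E →ₗ[ℝ] ℝ) ≠ 0 := by
    intro h
    obtain ⟨c, hc⟩ := hne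
    have h1 := hf c hc
    have h2 : ∀ z, f z = 0 := fun z ↦ LinearMap.congr_fun h z
    simp [h2] at h1
  have hker : Module.finrank ℝ (LinearMap.ker (f : E →ₗ[ℝ] ℝ)) = 1 := by
    have := Module.Dual.finrank_ker_add_one_of_ne_zero (f := (f : E →ₗ[ℝ] ℝ)) hf0
    omega
  have hv0 : y - x ≠ 0 := sub_ne_zero.2 hxy.symm
  have hv : y - x ∈ LinearMap.ker (f : E →ₗ[ℝ] ℝ) := by simp [hfx, hfy]
  have hline : ∀ z, f z = f p → ∃ s : ℝ, z = x + s • (y - x) := by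
    intro z hz
    have hzx : z - x ∈ LinearMap.ker (f : E →ₗ[ℝ] ℝ) := by simp [hfx, hz]
    obtain ⟨s, hs⟩ := exists_smul_eq_of_finrank_eq_one hker
      (x := ⟨y - x, hv⟩) (by simpa using hv0) ⟨z - x, hzx⟩
    refine ⟨s, ?_⟩
    have hs' : s • (y - x) = z - x := congrArg Subtype.val hs
    rw [hs']
    abel
  let g : ℝ → E := fun s ↦ x + s • (y - x)
  have hg : Continuous g := by fun_prop
  let K : Set ℝ := g ⁻¹' closure Ω
  have hKcl : IsClosed K := isClosed_closure.preimage hg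
  have hKb : Bornology.IsBounded K := by
    obtain ⟨R, hR⟩ := hΩb.closure.exists_norm_le
    rw [isBounded_iff_forall_norm_le]
    refine ⟨(R + ‖x‖) / ‖y - x‖, fun s hs ↦ ?_⟩
    rw [le_div_iff₀ (norm_pos_iff.2 hv0), ← norm_smul]
    have h1 : s • (y - x) = g s - x := by simp [g]
    rw [h1]
    exact (norm_sub_le _ _).trans (by gcongr; exact hR _ hs)
  have hKc : IsCompact K := Metric.isCompact_of_isClosed_isBounded hKcl hKb
  have h0 : (0 : ℝ) ∈ K := by simpa [K, g] using hx
  have h1 : (1 : ℝ) ∈ K := by simpa [K, g] using hy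
  have ha : sInf K ∈ K := hKc.sInf_mem ⟨0, h0⟩
  have hb : sSup K ∈ K := hKc.sSup_mem ⟨0, h0⟩
  have hle : ∀ s ∈ K, sInf K ≤ s ∧ s ≤ sSup K := fun s hs ↦
    ⟨csInf_le hKc.bddBelow hs, le_csSup hKc.bddAbove hs⟩
  have hlt : sInf K < sSup K := by
    have := (hle 0 h0).1
    have := (hle 1 h1).2
    linarith
  have hgf : ∀ s, f (g s) = f p := fun s ↦ by simp [g, hfx, hfy]
  have hfr : ∀ z ∈ closure Ω, f z = f p → z ∈ frontier Ω := by
    intro z hz hzp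
    rw [hΩo.frontier_eq]
    exact ⟨hz, fun h ↦ (hf z h).ne hzp⟩
  refine ⟨g (sInf K), hfr _ ha (hgf _), g (sSup K), hfr _ hb (hgf _), ?_, ?_, ?_⟩
  · intro h
    have : sInf K = sSup K := smul_left_injective ℝ hv0 (add_left_cancel h)
    exact hlt.ne this
  · intro z hz
    refine hfr z (hΩc.closure.segment_subset ha hb hz) ?_
    obtain ⟨s, t, -, -, hst, rfl⟩ := hz
    simp only [map_add, map_smul, hgf, smul_eq_mul]
    rw [← add_mul, hst, one_mul]
  · intro z hz hzp
    obtain ⟨s, rfl⟩ := hline z hzp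
    obtain ⟨hs1, hs2⟩ := hle s hz
    have hd : 0 < sSup K - sInf K := sub_pos.2 hlt
    refine ⟨(sSup K - s) / (sSup K - sInf K), (s - sInf K) / (sSup K - sInf K),
      div_nonneg (sub_nonneg.2 hs2) hd.le, div_nonneg (sub_nonneg.2 hs1) hd.le, ?_, ?_⟩
    · field_simp
      ring
    · simp only [g]
      match_scalars <;> field_simp <;> ring

/-- A ray issued from a point of an open convex set meets its frontier at most once. -/
theorem eq_of_ray_mem_frontier {E : Type*} [NormedAddCommGroup E] [NormedSpace ℝ E]
    {Ω : Set E} (hΩo : IsOpen Ω) (hΩc : Convex ℝ Ω) {c v : E} (hc : c ∈ Ω) {s t : ℝ}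
    (hs : 0 < s) (ht : 0 < t) (hsΩ : c + s • v ∈ frontier Ω) (htΩ : c + t • v ∈ frontier Ω) :
    s = t := by
  have key : ∀ s t : ℝ, 0 < s → s < t → c + s • v ∈ frontier Ω → c + t • v ∈ frontier Ω →
      False := by
    intro s t hs hst hsΩ htΩ
    have ht : 0 < t := hs.trans hst
    have hmem : c + s • v ∈ openSegment ℝ c (c + t • v) := by
      refine ⟨1 - s / t, s / t, by rw [sub_pos, div_lt_one ht]; exact hst, by positivity,
        by ring, ?_⟩
      match_scalars <;> field_simp; ring
    have := hΩc.openSegment_interior_closure_subset_interior (by rwa [hΩo.interior_eq])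
      htΩ.1 hmem
    exact hsΩ.2 this
  rcases lt_trichotomy s t with h | h | h
  · exact (key s t hs h hsΩ htΩ).elim
  · exact h
  · exact (key t s ht h htΩ hsΩ).elim

/-- In a plane, the open cone over an open segment whose line avoids the apex contains
a point of every dense set. -/
theorem exists_ray_mem_openSegment {E : Type*} [NormedAddCommGroup E] [NormedSpace ℝ E]
    (hE : Module.finrank ℝ E = 2) {c x y : E} (hli : LinearIndependent ℝ ![x - c, y - c])
    {D : Set E} (hD : Dense D) :
    ∃ q ∈ D, ∃ t : ℝ, 0 < t ∧ c + t • (q - c) ∈ openSegment ℝ x y := by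
  have : FiniteDimensional ℝ E := Module.finite_of_finrank_pos (by omega)
  let B := basisOfLinearIndependentOfCardEqFinrank hli (by simp [hE])
  have hB0 : B 0 = x - c := by simp [B]
  have hB1 : B 1 = y - c := by simp [B]
  have hcont : ∀ i, Continuous fun q ↦ B.coord i (q - c) := fun i ↦
    (B.coord i).continuous_of_finiteDimensional.comp (by fun_prop)
  let U : Set E := {q | 0 < B.coord 0 (q - c)} ∩ {q | 0 < B.coord 1 (q - c)}
  have hU : IsOpen U := (isOpen_lt continuous_const (hcont 0)).inter
    (isOpen_lt continuous_const (hcont 1))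
  have hne : U.Nonempty := by
    refine ⟨c + (B 0 + B 1), ?_, ?_⟩ <;> simp
  obtain ⟨q, hqD, hqU⟩ := hD.exists_mem_open hU hne
  obtain ⟨h0, h1⟩ := hqU
  have hq : q - c = B.coord 0 (q - c) • (x - c) + B.coord 1 (q - c) • (y - c) := by
    conv_lhs => rw [← B.sum_repr (q - c)]
    simp [Fin.sum_univ_two, hB0, hB1]
  simp only [mem_ofPred_eq] at h0 h1
  generalize B.coord 0 (q - c) = α at *
  generalize B.coord 1 (q - c) = β at *
  refine ⟨q, hqD, (α + β)⁻¹, by positivity, α / (α + β), β / (α + β), by positivity,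
    by positivity, by field_simp, ?_⟩
  rw [hq]
  match_scalars <;> field_simp; ring

/-- The frontier segments of a bounded open convex planar set are contained in
countably many of them. -/
theorem exists_countable_frontier_segments {E : Type*} [NormedAddCommGroup E]
    [NormedSpace ℝ E] (hE : Module.finrank ℝ E = 2) {Ω : Set E} (hΩo : IsOpen Ω)
    (hΩb : Bornology.IsBounded Ω) (hΩc : Convex ℝ Ω) :
    ∃ T : Set (E × E), T.Countable ∧
      (∀ s ∈ T, s.1 ∈ frontier Ω ∧ s.2 ∈ frontier Ω ∧ s.1 ≠ s.2 ∧
        segment ℝ s.1 s.2 ⊆ frontier Ω) ∧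
      ∀ x y, x ≠ y → segment ℝ x y ⊆ frontier Ω →
        ∃ s ∈ T, x ∈ segment ℝ s.1 s.2 ∧ y ∈ segment ℝ s.1 s.2 := by
  rcases Ω.eq_empty_or_nonempty with rfl | hne
  · exact ⟨∅, countable_empty, by simp, fun x y _ h ↦ by
      simpa using h (left_mem_segment ℝ x y)⟩
  obtain ⟨c, hc⟩ := hne
  have : FiniteDimensional ℝ E := Module.finite_of_finrank_pos (by omega)
  have : ProperSpace E := FiniteDimensional.proper ℝ E
  obtain ⟨D, hDc, hD⟩ := TopologicalSpace.exists_countable_dense E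
  let P : E → E → E → Prop := fun q x y ↦ x ≠ y ∧ segment ℝ x y ⊆ frontier Ω ∧
    ∃ t : ℝ, 0 < t ∧ c + t • (q - c) ∈ openSegment ℝ x y
  have hface : ∀ q, (∃ x y, P q x y) → ∃ s : E × E,
      (s.1 ∈ frontier Ω ∧ s.2 ∈ frontier Ω ∧ s.1 ≠ s.2 ∧ segment ℝ s.1 s.2 ⊆ frontier Ω) ∧
      ∀ x y, P q x y → x ∈ segment ℝ s.1 s.2 ∧ y ∈ segment ℝ s.1 s.2 := by
    rintro q ⟨x₀, y₀, hne₀, hseg₀, t₀, ht₀, hmem₀⟩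
    have hp := hseg₀ (openSegment_subset_segment ℝ x₀ y₀ hmem₀)
    obtain ⟨f, hf, hfcl⟩ := exists_supporting_functional hΩo hΩc hp
    have hends : ∀ x y, P q x y → (x ∈ closure Ω ∧ f x = f (c + t₀ • (q - c))) ∧
        (y ∈ closure Ω ∧ f y = f (c + t₀ • (q - c))) := by
      rintro x y ⟨-, hseg, t, ht, hmem⟩
      obtain rfl : t = t₀ := eq_of_ray_mem_frontier hΩo hΩc hc ht ht₀
        (hseg (openSegment_subset_segment ℝ x y hmem)) hp
      have hx := (hseg (left_mem_segment ℝ x y)).1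
      have hy := (hseg (right_mem_segment ℝ x y)).1
      obtain ⟨h1, h2⟩ := eq_of_mem_openSegment_of_le f hmem (hfcl x hx) (hfcl y hy)
      exact ⟨⟨hx, h1⟩, hy, h2⟩
    obtain ⟨⟨hx, hfx⟩, hy, hfy⟩ := hends x₀ y₀ ⟨hne₀, hseg₀, t₀, ht₀, hmem₀⟩
    obtain ⟨a, ha, b, hb, hab, hseg, hall⟩ := exists_segment_of_supporting_functional hE hΩo
      hΩb hΩc ⟨c, hc⟩ hf hne₀ hx hy hfx hfy
    refine ⟨(a, b), ⟨ha, hb, hab, hseg⟩, fun x y hxy ↦ ?_⟩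
    obtain ⟨⟨h1, h2⟩, h3, h4⟩ := hends x y hxy
    exact ⟨hall x h1 h2, hall y h3 h4⟩
  choose! S hS hSmem using hface
  refine ⟨S '' {q ∈ D | ∃ x y, P q x y}, (hDc.mono (sep_subset _ _)).image S, ?_, ?_⟩
  · rintro _ ⟨q, ⟨-, hq⟩, rfl⟩
    exact hS q hq
  · intro x y hxy hseg
    have hm : midpoint ℝ x y ∈ openSegment ℝ x y :=
      ⟨1 / 2, 1 / 2, by norm_num, by norm_num, by norm_num, by
        rw [midpoint_eq_smul_add, smul_add]; norm_num⟩
    obtain ⟨f, hf, hfcl⟩ := exists_supporting_functional hΩo hΩc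
      (hseg (openSegment_subset_segment ℝ x y hm))
    obtain ⟨h1, h2⟩ := eq_of_mem_openSegment_of_le f hm
      (hfcl x (hseg (left_mem_segment ℝ x y)).1) (hfcl y (hseg (right_mem_segment ℝ x y)).1)
    have hfc := hf c hc
    have hli : LinearIndependent ℝ ![x - c, y - c] := by
      rw [LinearIndependent.pair_iff]
      intro α β h
      have h3 := congrArg f h
      simp only [map_add, map_smul, map_sub, h1, h2, smul_eq_mul, map_zero, ← add_mul] at h3
      have h4 : β = -α := by
        rcases mul_eq_zero.1 h3 with h | h <;> linarith
      subst h4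
      have h5 : α • (x - y) = 0 := by
        rw [← h]
        module
      have h6 : α = 0 := (smul_eq_zero.1 h5).resolve_right (sub_ne_zero.2 hxy)
      simp [h6]
    obtain ⟨q, hqD, hq⟩ := exists_ray_mem_openSegment hE hli hD
    have hP : P q x y := ⟨hxy, hseg, hq⟩
    exact ⟨S q, ⟨q, ⟨hqD, x, y, hP⟩, rfl⟩, hSmem q ⟨x, y, hP⟩ x y hP⟩

/-- A chord of an open convex set that is not contained in the frontier meets it only at
its endpoints. -/
theorem segment_subset_frontier_or {E : Type*} [NormedAddCommGroup E] [NormedSpace ℝ E]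
    {Ω : Set E} (hΩo : IsOpen Ω) (hΩc : Convex ℝ Ω) {x y : E} (hx : x ∈ frontier Ω)
    (hy : y ∈ frontier Ω) : segment ℝ x y ⊆ frontier Ω ∨ segment ℝ x y ∩ frontier Ω ⊆ {x, y} := by
  by_cases h : ∃ z ∈ segment ℝ x y, z ∈ Ω
  · right
    obtain ⟨z, hz, hzΩ⟩ := h
    have hzi : z ∈ interior Ω := by rwa [hΩo.interior_eq]
    rintro w ⟨hw, hwf⟩
    by_contra hne
    simp only [mem_insert_iff, mem_singleton_iff, not_or] at hne
    have hzw : w ≠ z := fun h ↦ hwf.2 (h ▸ hzi)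
    have hsub : ∀ e ∈ frontier Ω, w ∈ segment ℝ z e → w ≠ e → False := fun e he hwe hne ↦
      hwf.2 (hΩc.openSegment_interior_closure_subset_interior hzi he.1
        (mem_openSegment_of_ne_left_right hzw.symm hne.symm hwe))
    rw [segment_eq_image_lineMap] at hz hw
    obtain ⟨s, hs, rfl⟩ := hz
    obtain ⟨t, ht, rfl⟩ := hw
    rcases le_total s t with hst | hst
    · refine hsub y hy ?_ hne.2
      have : AffineMap.lineMap x y t ∈ (AffineMap.lineMap x y : ℝ →ᵃ[ℝ] E) '' segment ℝ s 1 :=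
        mem_image_of_mem _ (by rw [segment_eq_Icc hs.2]; exact ⟨hst, ht.2⟩)
      rwa [image_segment, AffineMap.lineMap_apply_one] at this
    · refine hsub x hx ?_ hne.1
      have : AffineMap.lineMap x y t ∈ (AffineMap.lineMap x y : ℝ →ᵃ[ℝ] E) '' segment ℝ 0 s :=
        mem_image_of_mem _ (by rw [segment_eq_Icc hs.1]; exact ⟨ht.1, hst⟩)
      rwa [image_segment, AffineMap.lineMap_apply_zero, segment_symm] at this
  · left
    push Not at h
    intro z hz
    rw [hΩo.frontier_eq]
    exact ⟨hΩc.closure.segment_subset hx.1 hy.1 hz, h z hz⟩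

/-- on a (not necessarily strictly) convex planar domain, if for every
boundary segment at least one of `f⁺`, `f⁻` gives it no mass, then every optimal transport
plan between `f⁺` and `f⁻` has transport density giving no mass to the boundary. -/
theorem stmt16 (Ω : Set (EuclideanSpace ℝ (Fin 2)))
    (hΩo : IsOpen Ω) (hΩb : Bornology.IsBounded Ω) (hΩc : Convex ℝ Ω)
    (fplus fminus : Measure (EuclideanSpace ℝ (Fin 2)))
    [IsFiniteMeasure fplus] [IsFiniteMeasure fminus]
    (hfp : fplus ((frontier Ω)ᶜ) = 0) (hfm : fminus ((frontier Ω)ᶜ) = 0)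
    (hmass : fplus (frontier Ω) = fminus (frontier Ω))
    (hmin : ∀ x ∈ frontier Ω, ∀ y ∈ frontier Ω, x ≠ y → segment ℝ x y ⊆ frontier Ω →
      fplus (segment ℝ x y) = 0 ∨ fminus (segment ℝ x y) = 0)
    (γ : Measure (EuclideanSpace ℝ (Fin 2) × EuclideanSpace ℝ (Fin 2)))
    (hγ : IsOptimalPlan fplus fminus γ) :
    transportDensity γ (frontier Ω) = 0 := by
  obtain ⟨⟨hfst, hsnd⟩, -⟩ := hγ
  obtain ⟨T, hTc, hT, hcover⟩ := exists_countable_frontier_segments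
    (by simp : Module.finrank ℝ (EuclideanSpace ℝ (Fin 2)) = 2) hΩo hΩb hΩc
  have h1 : ∀ᵐ p ∂γ, p.1 ∈ frontier Ω := by
    apply ae_of_ae_map measurable_fst.aemeasurable
    rw [hfst]
    exact hfp
  have h2 : ∀ᵐ p ∂γ, p.2 ∈ frontier Ω := by
    apply ae_of_ae_map measurable_snd.aemeasurable
    rw [hsnd]
    exact hfm
  have h3 : ∀ᵐ p ∂γ, ∀ s ∈ T, ¬(p.1 ∈ segment ℝ s.1 s.2 ∧ p.2 ∈ segment ℝ s.1 s.2) := by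
    rw [ae_ball_iff hTc]
    intro s hs
    obtain ⟨ha, hb, hab, hseg⟩ := hT s hs
    rcases hmin _ ha _ hb hab hseg with h | h
    · have : ∀ᵐ p ∂γ, p.1 ∉ segment ℝ s.1 s.2 := by
        apply ae_of_ae_map (p := fun z ↦ z ∉ segment ℝ s.1 s.2) measurable_fst.aemeasurable
        rw [hfst]
        exact measure_eq_zero_iff_ae_notMem.1 h
      filter_upwards [this] with p hp hp'
      exact hp hp'.1
    · have : ∀ᵐ p ∂γ, p.2 ∉ segment ℝ s.1 s.2 := by
        apply ae_of_ae_map (p := fun z ↦ z ∉ segment ℝ s.1 s.2) measurable_snd.aemeasurable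
        rw [hsnd]
        exact measure_eq_zero_iff_ae_notMem.1 h
      filter_upwards [this] with p hp hp'
      exact hp hp'.2
  have := Measure.nullSingletonClass_hausdorff (EuclideanSpace ℝ (Fin 2)) one_pos
  have h0 : ∀ᵐ p ∂γ, μH[1] (segment ℝ p.1 p.2 ∩ frontier Ω) = 0 := by
    filter_upwards [h1, h2, h3] with p hp1 hp2 hp3
    have hsub : segment ℝ p.1 p.2 ∩ frontier Ω ⊆ {p.1, p.2} := by
      rcases eq_or_ne p.1 p.2 with h | h
      · rw [h, segment_same, pair_eq_singleton]
        exact inter_subset_left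
      · refine (segment_subset_frontier_or hΩo hΩc hp1 hp2).resolve_left fun hseg ↦ ?_
        obtain ⟨s, hs, hmem⟩ := hcover p.1 p.2 h hseg
        exact hp3 s hs hmem
    exact ((toFinite _).subset hsub).measure_zero _
  rw [transportDensity, lintegral_congr_ae h0, lintegral_zero]
end
end

section
/- Let φ : ℝ^d → ℝ be a 1-Lipschitz function and let x ≠ y be points with φ(x) − φ(y) = |x − y|. Then for every t ∈ (0,1), setting z_t = (1−t)x + ty, the function φ satisfies φ(z_t) = φ(x) − t|x − y|, and φ is differentiable at z_t with gradient ∇φ(z_t) = (x − y)/|x − y|. -/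
open MeasureTheory Set Metric Filter
open scoped ENNReal NNReal Topology

noncomputable section

/-- A function squeezed between two functions that touch it at `z` and have the same derivative
there has that derivative as well. -/
theorem hasFDerivAt_of_le_of_le {E : Type*} [NormedAddCommGroup E] [NormedSpace ℝ E]
    {f g h : E → ℝ} {L : E →L[ℝ] ℝ} {z : E} (hg : HasFDerivAt g L z) (hh : HasFDerivAt h L z)
    (hgf : ∀ w, g w ≤ f w) (hfh : ∀ w, f w ≤ h w) (hgz : g z = f z) (hhz : h z = f z) :
    HasFDerivAt f L z := by
  rw [hasFDerivAt_iff_isLittleO] at hg hh ⊢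
  refine (Asymptotics.IsBigO.of_bound 1 (Eventually.of_forall fun w => ?_)).trans_isLittleO
    (hg.norm_left.add hh.norm_left)
  have h₁ := hgf w
  have h₂ := hfh w
  simp only [Real.norm_eq_abs, one_mul, hgz, hhz]
  rw [abs_of_nonneg (a := _ + _) (by positivity), abs_le]
  constructor
  · linarith [neg_abs_le (g w - f z - L (w - z)), abs_nonneg (h w - f z - L (w - z))]
  · linarith [le_abs_self (h w - f z - L (w - z)), abs_nonneg (g w - f z - L (w - z))]

/-- Away from `a`, the distance to `a` is differentiable with gradient the unit vector pointing
away from `a`. -/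
theorem hasGradientAt_norm_sub {E : Type*} [NormedAddCommGroup E] [InnerProductSpace ℝ E]
    [CompleteSpace E] {a z : E} (h : z ≠ a) :
    HasGradientAt (fun w => ‖w - a‖) (‖z - a‖⁻¹ • (z - a)) z := by
  have hpos : 0 < ‖z - a‖ := norm_pos_iff.2 (sub_ne_zero.2 h)
  have hsq := (((hasFDerivAt_id z).sub_const a).norm_sq).sqrt (by simpa using hpos.ne')
  simp only [id, Real.sqrt_sq (norm_nonneg _)] at hsq
  rw [hasGradientAt_iff_hasFDerivAt]
  refine hsq.congr_fderiv ?_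
  ext v
  simp
  field_simp

/-- a `1`-Lipschitz function is affine along a transport ray and is
differentiable at every interior point of the ray with gradient the unit direction of
the ray. -/
theorem stmt18 {d : ℕ} (φ : EuclideanSpace ℝ (Fin d) → ℝ)
    (hφ : LipschitzWith 1 φ)
    (x y : EuclideanSpace ℝ (Fin d)) (hxy : x ≠ y)
    (hray : φ x - φ y = dist x y) :
    ∀ t ∈ Set.Ioo (0 : ℝ) 1,
      φ ((1 - t) • x + t • y) = φ x - t * dist x y ∧
      HasGradientAt φ ((dist x y)⁻¹ • (x - y)) ((1 - t) • x + t • y) := by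
  rintro t ⟨ht₀, ht₁⟩
  set z := (1 - t) • x + t • y with hz
  rw [dist_eq_norm] at hray ⊢
  have hsub : x - y ≠ 0 := sub_ne_zero.2 hxy
  have hpos : 0 < ‖x - y‖ := norm_pos_iff.2 hsub
  have hle (a b : EuclideanSpace ℝ (Fin d)) : φ a - φ b ≤ ‖a - b‖ := by
    have := hφ.dist_le_mul a b
    rw [Real.dist_eq, dist_eq_norm, NNReal.coe_one, one_mul] at this
    exact (le_abs_self _).trans this
  have hzx : z - x = (-t) • (x - y) := by rw [hz]; module
  have hzy : z - y = (1 - t) • (x - y) := by rw [hz]; module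
  have hnzx : ‖z - x‖ = t * ‖x - y‖ := by
    rw [hzx, norm_smul, norm_neg, Real.norm_of_nonneg ht₀.le]
  have hnzy : ‖z - y‖ = (1 - t) * ‖x - y‖ := by
    rw [hzy, norm_smul, Real.norm_of_nonneg (sub_nonneg.2 ht₁.le)]
  have hval : φ z = φ x - t * ‖x - y‖ := by
    have h₁ := hle x z
    have h₂ := hle z y
    rw [norm_sub_rev, hnzx] at h₁
    rw [hnzy] at h₂
    linarith
  refine ⟨hval, ?_⟩
  have hgx := hasGradientAt_norm_sub (a := x) (z := z)
    (sub_ne_zero.1 (hzx ▸ smul_ne_zero (neg_ne_zero.2 ht₀.ne') hsub))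
  have hgy := hasGradientAt_norm_sub (a := y) (z := z)
    (sub_ne_zero.1 (hzy ▸ smul_ne_zero (sub_ne_zero.2 ht₁.ne') hsub))
  have hux : ‖z - x‖⁻¹ • (z - x) = -(‖x - y‖⁻¹ • (x - y)) := by
    rw [hnzx, hzx, smul_smul, ← neg_smul]
    congr 1
    field_simp
  have huy : ‖z - y‖⁻¹ • (z - y) = ‖x - y‖⁻¹ • (x - y) := by
    have : 1 - t ≠ 0 := (sub_pos.2 ht₁).ne'
    rw [hnzy, hzy, smul_smul]
    congr 1
    field_simp
  rw [hux, hasGradientAt_iff_hasFDerivAt, map_neg] at hgx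
  rw [huy, hasGradientAt_iff_hasFDerivAt] at hgy
  rw [hasGradientAt_iff_hasFDerivAt]
  have hlower := hgx.const_sub (φ x)
  rw [neg_neg] at hlower
  refine hasFDerivAt_of_le_of_le hlower (hgy.const_add (φ y)) (fun w => ?_) (fun w => ?_) ?_ ?_
  · linarith [hle x w, norm_sub_rev x w]
  · linarith [hle w y]
  · linarith
  · linarith
end
end
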